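/- arXiv:2306.15210 — 4 statements merged into one kernel-verified Lean document; each statement's English description precedes it below -/
import Mathlib

section
/- (Pohozaev identities for the Hartree ground-state equation with inverse-square potential.) Let N ≥ 3, 0 < α < N, λ > −(N−2)²/4, τ > 0 with min{τ, α, N−α, N−τ, 2−2τ+α} > 0, and 1 + α/N < p < 1 + (2 − 2τ + α)/(N−2). Set B := Np − N − α + 2τ and A := 2p − B. Suppose φ : ℝ^N → ℂ is a nonzero Schwartz function that satisfies, for every x ∈ ℝ^N with x ≠ 0, the equation −Δφ(x) + λ φ(x)/|x|² + φ(x) = |x|^{−τ} |φ(x)|^{p−2} (J_α ∗ (|·|^{−τ}|φ|^p))(x) φ(x). Then P[φ] = (2p/A) ‖φ‖² and P[φ] = (2p/B) ‖√K_λ φ‖². -/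
open MeasureTheory

noncomputable def gradNormSq {N : ℕ} (u : EuclideanSpace ℝ (Fin N) → ℂ)
    (x : EuclideanSpace ℝ (Fin N)) : ℝ :=
  ∑ i, ‖fderiv ℝ u x (EuclideanSpace.single i 1)‖ ^ 2

/-- The quantity `‖√K_λ u‖²`. -/
noncomputable def kineticK {N : ℕ} (lam : ℝ) (u : EuclideanSpace ℝ (Fin N) → ℂ) : ℝ :=
  (∫ x, gradNormSq u x) + lam * ∫ x, ‖u x‖ ^ 2 / ‖x‖ ^ 2

/-- The Laplacian of a function on `ℝ^N`. -/
noncomputable def lap {N : ℕ} {E : Type*} [NormedAddCommGroup E] [NormedSpace ℝ E]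
    (u : EuclideanSpace ℝ (Fin N) → E) (x : EuclideanSpace ℝ (Fin N)) : E :=
  ∑ i, fderiv ℝ (fun y => fderiv ℝ u y (EuclideanSpace.single i 1)) x
    (EuclideanSpace.single i 1)

/-- The normalizing constant `c_{N,α}` of the Riesz potential. -/
noncomputable def rieszConst (N : ℕ) (α : ℝ) : ℝ :=
  Real.Gamma (((N : ℝ) - α) / 2) /
    (Real.Gamma (α / 2) * Real.pi ^ ((N : ℝ) / 2) * (2 : ℝ) ^ α)

/-- Convolution `J_α ∗ g` of the Riesz potential with a real-valued function. -/
noncomputable def rieszConvR {N : ℕ} (α : ℝ) (g : EuclideanSpace ℝ (Fin N) → ℝ)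
    (x : EuclideanSpace ℝ (Fin N)) : ℝ :=
  ∫ y, rieszConst N α * ‖x - y‖ ^ (α - (N : ℝ)) * g y

/-- The Hartree-type potential energy. -/
noncomputable def hartreeP {N : ℕ} (α τ p : ℝ) (u : EuclideanSpace ℝ (Fin N) → ℂ) : ℝ :=
  ∫ x, ‖x‖ ^ (-τ) * rieszConvR α (fun y => ‖y‖ ^ (-τ) * ‖u y‖ ^ p) x * ‖u x‖ ^ p

theorem aux_homog {E : Type*} [NormedAddCommGroup E] [NormedSpace ℝ E] [FiniteDimensional ℝ E]
    [MeasurableSpace E] [BorelSpace E] (μ : Measure E) [μ.IsAddHaarMeasure]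
    (w G G' b : E → ℝ) (a : ℝ)
    (hw : ∀ t : ℝ, 0 < t → ∀ x, w (t • x) = t ^ a * w x)
    (hwm : AEStronglyMeasurable w μ) (hG : Continuous G) (hG'm : AEStronglyMeasurable G' μ)
    (hd : ∀ x, ∀ t : ℝ, 0 < t → HasDerivAt (fun s : ℝ => G (s • x)) (G' (t • x) / t) t)
    (hb : ∀ x, ∀ t : ℝ, 1/2 < t → |G' (t • x)| ≤ b x)
    (hwb : Integrable (fun x => w x * b x) μ) (hwG : Integrable (fun x => w x * G x) μ) :
    Integrable (fun x => w x * G' x) μ ∧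
    ∫ x, w x * G' x ∂μ = -(Module.finrank ℝ E + a) * ∫ x, w x * G x ∂μ := by
  have key := hasDerivAt_integral_of_dominated_loc_of_deriv_le (μ := μ) (x₀ := (1:ℝ))
    (s := Set.Ioi (1/2)) (F := fun t x => w x * G (t • x))
    (F' := fun t x => w x * (G' (t • x) / t)) (bound := fun x => 2 * ‖w x * b x‖)
    (Ioi_mem_nhds (by norm_num))
    (Filter.Eventually.of_forall fun t =>
      hwm.mul (hG.comp (continuous_const_smul t)).aestronglyMeasurable)
    (by simpa using hwG) (by simp only [one_smul, div_one]; exact hwm.mul hG'm)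
    (Filter.Eventually.of_forall fun x t ht => by
      have ht' : (1/2:ℝ) < t := ht
      have h1 := hb x t ht'
      have hb0 : 0 ≤ b x := (abs_nonneg _).trans h1
      rw [norm_mul, norm_mul, norm_div, Real.norm_of_nonneg hb0,
        Real.norm_of_nonneg (by linarith : (0:ℝ) ≤ t), Real.norm_eq_abs (G' _)]
      have h2 : |G' (t • x)| / t ≤ 2 * b x := by
        rw [div_le_iff₀ (by linarith)]
        nlinarith
      have := mul_le_mul_of_nonneg_left h2 (norm_nonneg (w x))
      linarith)
    ((hwb.norm).const_mul 2)
    (Filter.Eventually.of_forall fun x t ht => by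
      have ht' : (1/2:ℝ) < t := ht
      exact (hd x t (by linarith)).const_mul (w x))
  obtain ⟨hint, hder⟩ := key
  simp only [one_smul, div_one] at hint hder
  refine ⟨hint, ?_⟩
  set n : ℝ := (Module.finrank ℝ E : ℝ) with hn
  have hsc : ∀ t : ℝ, 0 < t → ∫ x, w x * G (t • x) ∂μ = t ^ (-(n + a)) * ∫ x, w x * G x ∂μ := by
    intro t ht
    have h1 : ∀ x, w x * G (t • x) = t ^ (-a) * ((fun y => w y * G y) (t • x)) := by
      intro x
      simp only [hw t ht x]
      rw [Real.rpow_neg ht.le]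
      have := (Real.rpow_pos_of_pos ht a).ne'
      field_simp
    rw [funext h1]
    rw [integral_const_mul, Measure.integral_comp_smul_of_nonneg μ (fun y => w y * G y) t (hR := ht.le)]
    rw [neg_add, Real.rpow_add ht, Real.rpow_neg ht.le n, hn, Real.rpow_natCast, smul_eq_mul]
    ring
  have hder2 : HasDerivAt (fun t : ℝ => ∫ x, w x * G (t • x) ∂μ)
      (-(n + a) * ∫ x, w x * G x ∂μ) 1 := by
    have h := (Real.hasDerivAt_rpow_const (x := 1) (p := -(n+a)) (Or.inl one_ne_zero)).mul_const
      (∫ x, w x * G x ∂μ)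
    simp only [Real.one_rpow, mul_one] at h
    refine h.congr_of_eventuallyEq ?_
    filter_upwards [Ioi_mem_nhds (show (0:ℝ) < 1 by norm_num)] with t ht using hsc t ht
  exact hder.unique hder2

noncomputable def hh (N : ℕ) (x : EuclideanSpace ℝ (Fin N)) : ℝ := (1 + ‖x‖) ^ (-((N : ℝ) + 1))

theorem hh_pos {N : ℕ} (x : EuclideanSpace ℝ (Fin N)) : 0 < hh N x := by
  unfold hh; positivity

theorem hh_le_one {N : ℕ} (x : EuclideanSpace ℝ (Fin N)) : hh N x ≤ 1 := by
  unfold hh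
  apply Real.rpow_le_one_of_one_le_of_nonpos
  · linarith [norm_nonneg x]
  · have : (0:ℝ) ≤ N := Nat.cast_nonneg N
    linarith

theorem hh_cont {N : ℕ} : Continuous (hh N) := by
  unfold hh
  refine Continuous.rpow_const (by fun_prop) (fun x => Or.inl ?_)
  have := norm_nonneg x
  positivity

theorem hh_int {N : ℕ} : Integrable (hh N) := by
  unfold hh
  apply integrable_one_add_norm
  simp

theorem hh_smul {N : ℕ} (x : EuclideanSpace ℝ (Fin N)) (t : ℝ) (ht : 1/2 < t) :
    hh N (t • x) ≤ (2:ℝ) ^ ((N : ℝ) + 1) * hh N x := by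
  unfold hh
  have hx := norm_nonneg x
  have h1 : (1 + ‖x‖) / 2 ≤ 1 + ‖t • x‖ := by
    rw [norm_smul, Real.norm_of_nonneg (by linarith)]
    nlinarith
  have h2 : (1 + ‖t • x‖) ^ (-((N : ℝ) + 1)) ≤ ((1 + ‖x‖) / 2) ^ (-((N : ℝ) + 1)) := by
    apply Real.rpow_le_rpow_of_nonpos (by positivity) h1
    have : (0:ℝ) ≤ N := Nat.cast_nonneg N
    linarith
  refine h2.trans (le_of_eq ?_)
  rw [Real.div_rpow (by positivity) (by norm_num), Real.rpow_neg (by norm_num : (0:ℝ) ≤ 2)]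
  field_simp

/-- near part -/
noncomputable def nearK (N : ℕ) (r : ℝ) (x : EuclideanSpace ℝ (Fin N)) : ℝ :=
  (Set.Iio (1:ℝ)).indicator (fun y : ℝ => y ^ (-r)) ‖x‖

theorem nearK_nonneg {N : ℕ} (r : ℝ) (x : EuclideanSpace ℝ (Fin N)) : 0 ≤ nearK N r x := by
  unfold nearK
  apply Set.indicator_apply_nonneg
  intro _
  positivity

theorem nearK_int {N : ℕ} (hN : 3 ≤ N) (r : ℝ) (hr : r < N) : Integrable (nearK N r) := by
  unfold nearK
  have : Nontrivial (EuclideanSpace ℝ (Fin N)) := by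
    apply Module.nontrivial_of_finrank_pos (R := ℝ)
    simp; omega
  rw [integrable_fun_norm_addHaar]
  have h1 : IntegrableOn (fun y : ℝ => y ^ ((N:ℝ) - 1 - r)) (Set.Ioo 0 1) := by
    rw [intervalIntegral.integrableOn_Ioo_rpow_iff (by norm_num)]
    linarith
  rw [← integrable_indicator_iff measurableSet_Ioi]
  rw [← integrable_indicator_iff measurableSet_Ioo] at h1
  refine h1.congr (Filter.Eventually.of_forall fun y => ?_)
  simp only [finrank_euclideanSpace, Fintype.card_fin, smul_eq_mul]
  by_cases hy : 0 < y
  · by_cases hy1 : y < 1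
    · simp only [Set.indicator, Set.mem_Ioo, Set.mem_Ioi, Set.mem_Iio, hy, hy1, and_self, if_true]
      rw [← Real.rpow_natCast, ← Real.rpow_add hy]
      congr 1
      rw [Nat.cast_sub (by omega)]
      push_cast; ring
    · simp [Set.indicator, hy1]
  · simp [Set.indicator, hy]

theorem rpow_le_nearK {N : ℕ} (r : ℝ) (hr : 0 ≤ r) (x : EuclideanSpace ℝ (Fin N)) :
    ‖x‖ ^ (-r) ≤ nearK N r x + 1 := by
  unfold nearK
  by_cases h : ‖x‖ < 1
  · simp [Set.indicator, h]
  · simp only [Set.indicator, Set.mem_Iio, h, if_false, zero_add]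
    exact Real.rpow_le_one_of_one_le_of_nonpos (not_lt.mp h) (by linarith)

theorem norm_rpow_meas {N : ℕ} (r : ℝ) :
    Measurable (fun x : EuclideanSpace ℝ (Fin N) => ‖x‖ ^ r) := by fun_prop

/-- `‖x‖^(-r) * h` is integrable. -/
theorem int_rpow_hh {N : ℕ} (hN : 3 ≤ N) (r : ℝ) (hr0 : 0 ≤ r) (hr : r < N) :
    Integrable (fun x : EuclideanSpace ℝ (Fin N) => ‖x‖ ^ (-r) * hh N x) := by
  refine ((nearK_int hN r hr).add hh_int).mono'
    ((norm_rpow_meas _).mul hh_cont.measurable).aestronglyMeasurable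
    (Filter.Eventually.of_forall fun x => ?_)
  have h1 := rpow_le_nearK r hr0 x
  have h2 := hh_pos x
  have h3 := hh_le_one x
  have h4 := nearK_nonneg r x
  rw [Real.norm_of_nonneg (by positivity)]
  simp only [Pi.add_apply]
  nlinarith

/-- integrability of the two-point kernels -/
theorem int_conv {N : ℕ} (hN : 3 ≤ N) (r s : ℝ) (hr0 : 0 ≤ r) (hr : r < N)
    (hs0 : 0 ≤ s) (hs : s < N) :
    Integrable (fun z : EuclideanSpace ℝ (Fin N) × EuclideanSpace ℝ (Fin N) =>
      ‖z.2‖ ^ (-r) * ‖z.1 - z.2‖ ^ (-s) * (hh N z.1 * hh N z.2)) (volume.prod volume) := by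
  have f1 := int_rpow_hh hN r hr0 hr
  have I1 := f1.convolution_integrand (ContinuousLinearMap.mul ℝ ℝ) (nearK_int hN s hs)
  have I2 := (hh_int (N := N)).mul_prod f1
  refine (I1.add I2).mono' (by
    have := norm_rpow_meas (N := N)
    have := (hh_cont (N := N)).measurable
    apply Measurable.aestronglyMeasurable
    fun_prop) (Filter.Eventually.of_forall fun z => ?_)
  have h1 := rpow_le_nearK s hs0 (z.1 - z.2)
  have h2 := hh_pos z.1
  have h2' := hh_pos z.2
  have h3 := hh_le_one z.1
  have h4 := nearK_nonneg s (z.1 - z.2)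
  rw [Real.norm_of_nonneg (by positivity)]
  simp only [Pi.add_apply, ContinuousLinearMap.mul_apply']
  have hA : 0 ≤ ‖z.2‖ ^ (-r) * hh N z.2 := by positivity
  have hB : ‖z.1 - z.2‖ ^ (-s) * hh N z.1 ≤ nearK N s (z.1 - z.2) + hh N z.1 := by nlinarith
  have := mul_le_mul_of_nonneg_left hB hA
  linarith

theorem int_conv' {N : ℕ} (hN : 3 ≤ N) (r s : ℝ) (hr0 : 0 ≤ r) (hr : r < N)
    (hs0 : 0 ≤ s) (hs : s < N) :
    Integrable (fun z : EuclideanSpace ℝ (Fin N) × EuclideanSpace ℝ (Fin N) =>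
      ‖z.1‖ ^ (-r) * ‖z.1 - z.2‖ ^ (-s) * (hh N z.1 * hh N z.2)) (volume.prod volume) := by
  refine (int_conv hN r s hr0 hr hs0 hs).swap.congr (Filter.Eventually.of_forall fun z => ?_)
  simp only [Function.comp, Prod.fst_swap, Prod.snd_swap, norm_sub_rev z.2 z.1]
  ring

theorem kernel_bound_aux (a b c τ k r s : ℝ) (ha : 0 < a) (hb : 0 < b) (hc : 0 < c) (hab : a ≤ b)
    (hk : 0 < k) (hs : k ≤ s) (hr : τ ≤ r) (hsum : r + s = 2 * τ + k) :
    a ^ (-τ) * b ^ (-τ) * c ^ (-k) ≤ a ^ (-r) * c ^ (-s) + a ^ (-r) * b ^ (-s) := by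
  -- b^{-τ} = b^{-(r-τ)} b^{-(s-k)}
  have e1 : b ^ (-τ) = b ^ (-(r - τ)) * b ^ (-(s - k)) := by
    rw [← Real.rpow_add hb]; congr 1; linarith
  have e2 : b ^ (-(r - τ)) ≤ a ^ (-(r - τ)) :=
    Real.rpow_le_rpow_of_nonpos ha hab (by linarith)
  have e3 : a ^ (-r) = a ^ (-τ) * a ^ (-(r - τ)) := by
    rw [← Real.rpow_add ha]; congr 1; ring
  have e4 : b ^ (-(s - k)) * c ^ (-k) ≤ c ^ (-s) + b ^ (-s) := by
    rcases le_total b c with h | h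
    · have : c ^ (-k) ≤ b ^ (-k) := Real.rpow_le_rpow_of_nonpos hb h (by linarith)
      have e5 : b ^ (-s) = b ^ (-(s - k)) * b ^ (-k) := by
        rw [← Real.rpow_add hb]; congr 1; ring
      have : b ^ (-(s - k)) * c ^ (-k) ≤ b ^ (-(s - k)) * b ^ (-k) := by gcongr
      have : 0 ≤ c ^ (-s) := by positivity
      linarith
    · have : b ^ (-(s - k)) ≤ c ^ (-(s - k)) := Real.rpow_le_rpow_of_nonpos hc h (by linarith)
      have e5 : c ^ (-s) = c ^ (-(s - k)) * c ^ (-k) := by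
        rw [← Real.rpow_add hc]; congr 1; ring
      have : b ^ (-(s - k)) * c ^ (-k) ≤ c ^ (-(s - k)) * c ^ (-k) := by gcongr
      have : 0 ≤ b ^ (-s) := by positivity
      linarith
  calc a ^ (-τ) * b ^ (-τ) * c ^ (-k)
      = a ^ (-τ) * (b ^ (-(r - τ)) * (b ^ (-(s - k)) * c ^ (-k))) := by rw [e1]; ring
    _ ≤ a ^ (-τ) * (a ^ (-(r - τ)) * (c ^ (-s) + b ^ (-s))) := by gcongr
    _ = _ := by rw [e3]; ring

noncomputable def WW (N : ℕ) (τ α : ℝ)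
    (z : EuclideanSpace ℝ (Fin N) × EuclideanSpace ℝ (Fin N)) : ℝ :=
  ‖z.1‖ ^ (-τ) * ‖z.2‖ ^ (-τ) * ‖z.1 - z.2‖ ^ (α - (N:ℝ))

theorem WW_meas {N : ℕ} (τ α : ℝ) : Measurable (WW N τ α) := by
  unfold WW; fun_prop

theorem WW_nonneg {N : ℕ} (τ α : ℝ) (z) : 0 ≤ WW N τ α z := by
  unfold WW; positivity

theorem WW_int {N : ℕ} (hN : 3 ≤ N) (τ α : ℝ) (hα : 0 < α) (hαN : α < N) (hτ : 0 < τ)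
    (hτN : τ < N) (h2 : 2 * τ < N + α) :
    Integrable (fun z => WW N τ α z * (hh N z.1 * hh N z.2)) (volume.prod volume) := by
  obtain ⟨σ, hσ1, hσ2⟩ : ∃ σ, max 0 (2 * τ - N) < σ ∧ σ < min τ α := by
    apply exists_between
    simp only [max_lt_iff, lt_min_iff]
    refine ⟨⟨hτ, ?_⟩, hα, ?_⟩ <;> linarith
  simp only [max_lt_iff, lt_min_iff] at hσ1 hσ2
  set r := 2 * τ - σ with hr
  set s := (N:ℝ) - α + σ with hs
  have r0 : 0 ≤ r := by linarith
  have rN : r < N := by linarith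
  have s0 : 0 ≤ s := by linarith
  have sN : s < N := by linarith
  have I1 := int_conv' hN r s r0 rN s0 sN
  have I2 := int_conv hN r s r0 rN s0 sN
  have I3 := (int_rpow_hh hN r r0 rN).mul_prod (int_rpow_hh hN s s0 sN)
  have I4 := (int_rpow_hh hN s s0 sN).mul_prod (int_rpow_hh hN r r0 rN)
  refine ((I1.add I3).add (I2.add I4)).mono' (by
    have := (hh_cont (N := N)).measurable
    have := WW_meas (N := N) τ α
    apply Measurable.aestronglyMeasurable
    fun_prop) (Filter.Eventually.of_forall fun z => ?_)
  have p1 := hh_pos z.1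
  have p2 := hh_pos z.2
  have pW := WW_nonneg τ α z
  rw [Real.norm_of_nonneg (by positivity)]
  simp only [Pi.add_apply]
  have q1 : 0 ≤ ‖z.1‖ ^ (-r) * ‖z.1 - z.2‖ ^ (-s) + ‖z.1‖ ^ (-r) * ‖z.2‖ ^ (-s) := by positivity
  have q2 : 0 ≤ ‖z.2‖ ^ (-r) * ‖z.1 - z.2‖ ^ (-s) + ‖z.2‖ ^ (-r) * ‖z.1‖ ^ (-s) := by positivity
  have main : WW N τ α z ≤ (‖z.1‖ ^ (-r) * ‖z.1 - z.2‖ ^ (-s) + ‖z.1‖ ^ (-r) * ‖z.2‖ ^ (-s)) +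
      (‖z.2‖ ^ (-r) * ‖z.1 - z.2‖ ^ (-s) + ‖z.2‖ ^ (-r) * ‖z.1‖ ^ (-s)) := by
    rcases (norm_nonneg z.1).eq_or_lt' with h | ha
    · unfold WW
      rw [h, Real.zero_rpow (by linarith : -τ ≠ 0)]
      rw [h] at q1 q2
      linarith
    rcases (norm_nonneg z.2).eq_or_lt' with h | hb
    · unfold WW
      rw [h, Real.zero_rpow (by linarith : -τ ≠ 0)]
      rw [h] at q1 q2
      linarith
    rcases (norm_nonneg (z.1 - z.2)).eq_or_lt' with h | hc
    · unfold WW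
      rw [h, Real.zero_rpow (by linarith : α - N ≠ 0)]
      rw [h] at q1 q2
      linarith
    have hk : α - (N:ℝ) = -(N - α) := by ring
    unfold WW
    rw [hk]
    rcases le_total ‖z.1‖ ‖z.2‖ with h | h
    · have := kernel_bound_aux _ _ _ τ (N - α) r s ha hb hc h (by linarith) (by linarith)
        (by linarith) (by linarith)
      linarith
    · have := kernel_bound_aux _ _ _ τ (N - α) r s hb ha hc h (by linarith) (by linarith)
        (by linarith) (by linarith)
      linarith
  have := mul_le_mul_of_nonneg_right main (mul_pos p1 p2).le
  linarith
open scoped SchwartzMap LineDeriv RealInnerProductSpace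

theorem schwartz_decay {N : ℕ} (ψ : 𝓢(EuclideanSpace ℝ (Fin N), ℂ)) :
    ∃ C : ℝ, 0 ≤ C ∧ ∀ x, ‖ψ x‖ ≤ C * hh N x := by
  refine ⟨2 ^ (N+1) * (Finset.Iic (N+1, 0)).sup (fun m => SchwartzMap.seminorm ℝ m.1 m.2) ψ,
    by positivity, fun x => ?_⟩
  have h := SchwartzMap.one_add_le_sup_seminorm_apply (𝕜 := ℝ) (m := (N+1, 0)) (k := N+1) (n := 0)
    le_rfl le_rfl ψ x
  rw [norm_iteratedFDeriv_zero] at h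
  have hx : 0 < (1 + ‖x‖) ^ (N+1) := by positivity
  have e : hh N x = ((1 + ‖x‖) ^ (N+1))⁻¹ := by
    unfold hh
    rw [Real.rpow_neg (by positivity)]
    norm_cast
  rw [e, ← div_eq_mul_inv, le_div_iff₀ hx, mul_comm]
  exact h

noncomputable def rad {N : ℕ} (ψ : 𝓢(EuclideanSpace ℝ (Fin N), ℂ)) :
    𝓢(EuclideanSpace ℝ (Fin N), ℂ) :=
  SchwartzMap.bilinLeftCLM (ContinuousLinearMap.id ℝ (EuclideanSpace ℝ (Fin N) →L[ℝ] ℂ))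
    (Function.HasTemperateGrowth.id') (SchwartzMap.fderivCLM ℝ _ _ ψ)

theorem rad_apply {N : ℕ} (ψ : 𝓢(EuclideanSpace ℝ (Fin N), ℂ)) (x) :
    rad ψ x = fderiv ℝ ψ x x := rfl

noncomputable def gp {N : ℕ} (p : ℝ) (ψ : 𝓢(EuclideanSpace ℝ (Fin N), ℂ))
    (x : EuclideanSpace ℝ (Fin N)) : ℝ := ‖ψ x‖ ^ p

noncomputable def gd {N : ℕ} (p : ℝ) (ψ : 𝓢(EuclideanSpace ℝ (Fin N), ℂ))
    (x : EuclideanSpace ℝ (Fin N)) : ℝ := p * ‖ψ x‖ ^ (p - 2) * inner ℝ (ψ x) (rad ψ x)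

theorem gp_nonneg {N : ℕ} (p : ℝ) (ψ : 𝓢(EuclideanSpace ℝ (Fin N), ℂ)) (x) : 0 ≤ gp p ψ x := by
  unfold gp; positivity

theorem gp_cont {N : ℕ} (p : ℝ) (hp : 1 < p) (ψ : 𝓢(EuclideanSpace ℝ (Fin N), ℂ)) :
    Continuous (gp p ψ) := by
  unfold gp
  exact Continuous.rpow_const ψ.continuous.norm (fun x => Or.inr (by linarith))

theorem gd_meas {N : ℕ} (p : ℝ) (ψ : 𝓢(EuclideanSpace ℝ (Fin N), ℂ)) :
    Measurable (gd p ψ) := by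
  unfold gd
  have h1 := ψ.continuous.measurable
  have h2 : Measurable fun x => inner ℝ (ψ x) (rad ψ x) :=
    (ψ.continuous.inner (rad ψ).continuous).measurable
  exact ((h1.norm.pow_const _).const_mul p).mul h2

theorem g_bound {N : ℕ} (p : ℝ) (hp : 1 < p) (ψ : 𝓢(EuclideanSpace ℝ (Fin N), ℂ)) :
    ∃ C : ℝ, 0 ≤ C ∧ (∀ x, gp p ψ x ≤ C * hh N x) ∧ (∀ x, |gd p ψ x| ≤ C * hh N x) := by
  obtain ⟨C1, hC1, h1⟩ := schwartz_decay ψ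
  obtain ⟨C2, hC2, h2⟩ := schwartz_decay (rad ψ)
  have hp1 : 0 ≤ p - 1 := by linarith
  have hb : ∀ x, ‖ψ x‖ ≤ C1 := fun x => by
    have := mul_le_mul_of_nonneg_left (hh_le_one x) hC1
    linarith [h1 x]
  refine ⟨p * C1 ^ (p-1) * (C1 + C2), by positivity, fun x => ?_, fun x => ?_⟩
  · have e : gp p ψ x = ‖ψ x‖ ^ (p-1) * ‖ψ x‖ := by
      unfold gp
      rw [← Real.rpow_add_one' (norm_nonneg _) (by linarith)]
      congr 1; ring
    rw [e]
    have hh0 := hh_pos x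
    calc ‖ψ x‖ ^ (p-1) * ‖ψ x‖ ≤ C1 ^ (p-1) * (C1 * hh N x) := by
          gcongr
          · exact hb x
          · exact h1 x
      _ ≤ p * (C1 ^ (p-1) * (C1 * hh N x)) := le_mul_of_one_le_left (by positivity) hp.le
      _ ≤ p * C1 ^ (p-1) * (C1 + C2) * hh N x := by
          have : 0 ≤ p * C1 ^ (p-1) * C2 * hh N x := by positivity
          linarith
  · unfold gd
    have hh0 := hh_pos x
    rw [abs_mul, abs_of_nonneg (by positivity : 0 ≤ p * ‖ψ x‖ ^ (p - 2))]
    have hin : |inner ℝ (ψ x) (rad ψ x)| ≤ ‖ψ x‖ * ‖rad ψ x‖ := abs_real_inner_le_norm _ _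
    have e : ‖ψ x‖ ^ (p-2) * ‖ψ x‖ = ‖ψ x‖ ^ (p-1) := by
      rw [← Real.rpow_add_one' (norm_nonneg _) (by linarith)]
      congr 1; ring
    calc p * ‖ψ x‖ ^ (p - 2) * |inner ℝ (ψ x) (rad ψ x)|
        ≤ p * ‖ψ x‖ ^ (p - 2) * (‖ψ x‖ * ‖rad ψ x‖) := by gcongr
      _ = p * ‖ψ x‖ ^ (p-1) * ‖rad ψ x‖ := by rw [← e]; ring
      _ ≤ p * C1 ^ (p-1) * (C2 * hh N x) := by
          gcongr
          · exact hb x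
          · exact h2 x
      _ ≤ p * C1 ^ (p-1) * (C1 + C2) * hh N x := by
          have : 0 ≤ p * C1 ^ (p-1) * C1 * hh N x := by positivity
          linarith

theorem g_deriv {N : ℕ} (p : ℝ) (hp : 1 < p) (ψ : 𝓢(EuclideanSpace ℝ (Fin N), ℂ))
    (x : EuclideanSpace ℝ (Fin N)) (t : ℝ) (ht : 0 < t) :
    HasDerivAt (fun s : ℝ => gp p ψ (s • x)) (gd p ψ (t • x) / t) t := by
  have h1 : HasDerivAt (fun s : ℝ => s • x) ((1:ℝ) • x) t := (hasDerivAt_id t).smul_const x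
  have h2 := (ψ.hasFDerivAt (t • x)).comp_hasDerivAt t h1
  have h3 := (hasFDerivAt_norm_rpow (ψ (t • x)) hp).comp_hasDerivAt t h2
  unfold gp
  convert! h3 using 1
  simp only [gd, rad_apply, map_smul, one_smul, smul_apply, innerSL_apply_apply,
    smul_eq_mul, inner_smul_right]
  field_simp

/-- one-variable radial identity -/
theorem rad_one {N : ℕ} (p : ℝ) (hp : 1 < p) (ψ : 𝓢(EuclideanSpace ℝ (Fin N), ℂ))
    (w : EuclideanSpace ℝ (Fin N) → ℝ) (a : ℝ)
    (hw : ∀ t : ℝ, 0 < t → ∀ x, w (t • x) = t ^ a * w x) (hwm : Measurable w)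
    (hwh : Integrable (fun x => w x * hh N x)) :
    Integrable (fun x => w x * gp p ψ x) ∧ Integrable (fun x => w x * gd p ψ x) ∧
    ∫ x, w x * gd p ψ x = -(N + a) * ∫ x, w x * gp p ψ x := by
  obtain ⟨C, hC, hb1, hb2⟩ := g_bound p hp ψ
  have I1 : Integrable (fun x => w x * gp p ψ x) := by
    refine (hwh.norm.const_mul C).mono' (hwm.mul (gp_cont p hp ψ).measurable).aestronglyMeasurable
      (Filter.Eventually.of_forall fun x => ?_)
    rw [norm_mul, norm_mul, Real.norm_of_nonneg (hh_pos x).le, Real.norm_of_nonneg (gp_nonneg _ _ _)]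
    have := mul_le_mul_of_nonneg_left (hb1 x) (norm_nonneg (w x))
    linarith
  have key := aux_homog volume w (gp p ψ) (gd p ψ) (fun x => C * (2 ^ ((N:ℝ)+1) * hh N x)) a hw
    hwm.aestronglyMeasurable (gp_cont p hp ψ) (gd_meas p ψ).aestronglyMeasurable
    (g_deriv p hp ψ) (fun x t ht => (hb2 _).trans (by gcongr; exact hh_smul x t ht))
    ((hwh.const_mul (C * 2 ^ ((N:ℝ)+1))).congr (Filter.Eventually.of_forall fun x => by
      simp only; ring)) I1
  refine ⟨I1, key.1, ?_⟩
  rw [key.2]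
  simp

theorem WW_homog {N : ℕ} (τ α : ℝ) (t : ℝ) (ht : 0 < t) (z) :
    WW N τ α (t • z) = t ^ (-2 * τ + α - N) * WW N τ α z := by
  unfold WW
  simp only [Prod.smul_fst, Prod.smul_snd, ← smul_sub, norm_smul, Real.norm_of_nonneg ht.le]
  rw [Real.mul_rpow ht.le (norm_nonneg _), Real.mul_rpow ht.le (norm_nonneg _),
    Real.mul_rpow ht.le (norm_nonneg _),
    show -2 * τ + α - (N:ℝ) = -τ + -τ + (α - N) by ring, Real.rpow_add ht, Real.rpow_add ht]
  ring

theorem rad_two {N : ℕ} (hN : 3 ≤ N) (τ α : ℝ) (hα : 0 < α) (hαN : α < N) (hτ : 0 < τ)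
    (hτN : τ < N) (h2 : 2 * τ < N + α)
    (p : ℝ) (hp : 1 < p) (ψ : 𝓢(EuclideanSpace ℝ (Fin N), ℂ)) :
    Integrable (fun z => WW N τ α z * (gp p ψ z.1 * gp p ψ z.2)) (volume.prod volume) ∧
    Integrable (fun z => WW N τ α z * (gd p ψ z.1 * gp p ψ z.2)) (volume.prod volume) ∧
    2 * ∫ z, WW N τ α z * (gd p ψ z.1 * gp p ψ z.2) ∂(volume.prod volume) =
      -(N + α - 2 * τ) * ∫ z, WW N τ α z * (gp p ψ z.1 * gp p ψ z.2) ∂(volume.prod volume) := by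
  obtain ⟨C, hC, hb1, hb2⟩ := g_bound p hp ψ
  have hI := WW_int hN τ α hα hαN hτ hτN h2
  have mW := WW_meas (N := N) τ α
  have mg := (gp_cont p hp ψ).measurable
  have mgd := gd_meas p ψ
  have gen : ∀ u v : EuclideanSpace ℝ (Fin N) → ℝ, Measurable u → Measurable v →
      (∀ x, |u x| ≤ C * hh N x) → (∀ x, |v x| ≤ C * hh N x) →
      Integrable (fun z => WW N τ α z * (u z.1 * v z.2)) (volume.prod volume) := by
    intro u v mu mv hu hv
    refine (hI.const_mul (C * C)).mono' (by
      apply Measurable.aestronglyMeasurable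
      fun_prop) (Filter.Eventually.of_forall fun z => ?_)
    have p1 := hh_pos z.1
    have p2 := hh_pos z.2
    have pW := WW_nonneg τ α z
    rw [Real.norm_eq_abs, abs_mul, abs_mul, abs_of_nonneg pW]
    calc WW N τ α z * (|u z.1| * |v z.2|)
        ≤ WW N τ α z * ((C * hh N z.1) * (C * hh N z.2)) := by
          gcongr
          · exact hu _
          · exact hv _
      _ = _ := by ring
  have hb1' : ∀ x, |gp p ψ x| ≤ C * hh N x := fun x => by
    rw [abs_of_nonneg (gp_nonneg _ _ _)]; exact hb1 x
  have I1 := gen _ _ mg mg hb1' hb1'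
  have I2 := gen _ _ mgd mg hb2 hb1'
  have I3 := gen _ _ mg mgd hb1' hb2
  have key := aux_homog (volume.prod volume) (WW N τ α) (fun z => gp p ψ z.1 * gp p ψ z.2)
    (fun z => gd p ψ z.1 * gp p ψ z.2 + gp p ψ z.1 * gd p ψ z.2)
    (fun z => 2 * ((C * (2 ^ ((N:ℝ)+1) * hh N z.1)) * (C * (2 ^ ((N:ℝ)+1) * hh N z.2))))
    (-2 * τ + α - N) (fun t ht z => WW_homog τ α t ht z) mW.aestronglyMeasurable
    (by
      have := gp_cont p hp ψ
      fun_prop)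
    (by
      apply Measurable.aestronglyMeasurable
      fun_prop)
    (fun z t ht => by
      have d1 := g_deriv p hp ψ z.1 t ht
      have d2 := g_deriv p hp ψ z.2 t ht
      convert! d1.mul d2 using 1
      simp only [Prod.smul_fst, Prod.smul_snd]
      ring)
    (fun z t ht => by
      simp only [Prod.smul_fst, Prod.smul_snd]
      have a1 := (hb1' (t • z.1)).trans (mul_le_mul_of_nonneg_left (hh_smul z.1 t ht) hC)
      have a2 := (hb1' (t • z.2)).trans (mul_le_mul_of_nonneg_left (hh_smul z.2 t ht) hC)
      have b1 := (hb2 (t • z.1)).trans (mul_le_mul_of_nonneg_left (hh_smul z.1 t ht) hC)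
      have b2 := (hb2 (t • z.2)).trans (mul_le_mul_of_nonneg_left (hh_smul z.2 t ht) hC)
      refine (abs_add_le _ _).trans ?_
      rw [abs_mul, abs_mul, two_mul]
      have p1 := hh_pos z.1
      have p2 := hh_pos z.2
      exact add_le_add (mul_le_mul b1 a2 (abs_nonneg _) (by positivity))
        (mul_le_mul a1 b2 (abs_nonneg _) (by positivity)))
    ((hI.const_mul (2 * (C * 2 ^ ((N:ℝ)+1)) ^ 2)).congr (Filter.Eventually.of_forall fun x => by
      simp only; ring)) I1
  refine ⟨I1, I2, ?_⟩
  have sw : ∫ z, WW N τ α z * (gp p ψ z.1 * gd p ψ z.2) ∂(volume.prod volume) =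
      ∫ z, WW N τ α z * (gd p ψ z.1 * gp p ψ z.2) ∂(volume.prod volume) := by
    rw [← integral_prod_swap]
    refine integral_congr_ae (Filter.Eventually.of_forall fun z => ?_)
    simp only [WW, Prod.fst_swap, Prod.snd_swap, norm_sub_rev z.2 z.1]
    ring
  have key2 := key.2
  simp only [mul_add] at key2
  rw [integral_add I2 I3, sw] at key2
  rw [two_mul, key2]
  simp only [Module.finrank_prod, finrank_euclideanSpace, Fintype.card_fin]
  push_cast
  ring

/-- Pairing a Fubini expression. -/
theorem fubini_pair {N : ℕ} (τ α c : ℝ) (u v : EuclideanSpace ℝ (Fin N) → ℝ)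
    (hI : Integrable (fun z => WW N τ α z * (u z.1 * v z.2)) (volume.prod volume)) :
    ∫ x, ‖x‖ ^ (-τ) * (∫ y, c * ‖x - y‖ ^ (α - (N : ℝ)) * (‖y‖ ^ (-τ) * v y)) * u x =
      c * ∫ z, WW N τ α z * (u z.1 * v z.2) ∂(volume.prod volume) := by
  rw [integral_prod _ hI, ← integral_const_mul]
  refine integral_congr_ae (Filter.Eventually.of_forall fun x => ?_)
  simp only
  rw [← integral_const_mul, ← integral_const_mul, ← integral_mul_const]
  refine integral_congr_ae (Filter.Eventually.of_forall fun y => ?_)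
  simp only [WW]
  ring

/-- integration by parts -/
theorem ibp {N : ℕ} (ψ χ : 𝓢(EuclideanSpace ℝ (Fin N), ℂ)) :
    ∫ x, inner ℝ (lap ψ x) (χ x) = - ∑ i, ∫ x, inner ℝ (fderiv ℝ ψ x (EuclideanSpace.single i 1))
      (fderiv ℝ χ x (EuclideanSpace.single i 1)) := by
  have hi : ∀ a b : 𝓢(EuclideanSpace ℝ (Fin N), ℂ), Integrable (fun x => inner ℝ (a x) (b x)) :=
    fun a b => (SchwartzMap.pairing (innerSL ℝ) a b).integrable
  have e : ∀ x, inner ℝ (lap ψ x) (χ x) =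
      ∑ i : Fin N, inner ℝ ((∂_{EuclideanSpace.single i (1:ℝ)} (∂_{EuclideanSpace.single i (1:ℝ)} ψ :
        𝓢(EuclideanSpace ℝ (Fin N), ℂ)) : 𝓢(EuclideanSpace ℝ (Fin N), ℂ)) x) (χ x) := by
    intro x
    rw [← sum_inner]
    rfl
  simp_rw [e]
  rw [integral_finsetSum _ (fun i _ => hi _ _), ← Finset.sum_neg_distrib]
  refine Finset.sum_congr rfl fun i _ => ?_
  have := SchwartzMap.integral_bilinear_lineDerivOp_right_eq_neg_left (μ := volume)
    (∂_{EuclideanSpace.single i (1:ℝ)} ψ) χ (innerSL ℝ) (EuclideanSpace.single i (1:ℝ))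
  exact (neg_eq_iff_eq_neg.mpr this).symm

theorem fderiv_rad {N : ℕ} (ψ : 𝓢(EuclideanSpace ℝ (Fin N), ℂ)) (x v : EuclideanSpace ℝ (Fin N)) :
    fderiv ℝ (rad ψ) x v = rad (∂_{v} ψ) x + fderiv ℝ ψ x v := by
  have hs : ContDiff ℝ 2 ψ := ψ.smooth 2
  have hd : DifferentiableAt ℝ (fderiv ℝ ψ) x :=
    ((hs.fderiv_right (m := 1) (by norm_num)).differentiable (by norm_num)) x
  have h1 : HasFDerivAt (fun y => fderiv ℝ ψ y y) _ x := hd.hasFDerivAt.clm_apply (hasFDerivAt_id x)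
  have h2 : fderiv ℝ (rad ψ) x = _ := h1.fderiv
  have h3 : HasFDerivAt (fun y => fderiv ℝ ψ y v) _ x :=
    hd.hasFDerivAt.clm_apply (hasFDerivAt_const v x)
  have h4 : fderiv ℝ (∂_{v} ψ : 𝓢(EuclideanSpace ℝ (Fin N), ℂ)) x = _ := h3.fderiv
  have sym := (hs.contDiffAt (x := x)).isSymmSndFDerivAt (by simp)
  rw [rad_apply, h4, h2]
  simp [sym.eq x v, add_comm]

theorem gp_two {N : ℕ} (ψ : 𝓢(EuclideanSpace ℝ (Fin N), ℂ)) (x) : gp 2 ψ x = ‖ψ x‖ ^ 2 := by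
  unfold gp; norm_cast

theorem gd_two {N : ℕ} (ψ : 𝓢(EuclideanSpace ℝ (Fin N), ℂ)) (x) :
    gd 2 ψ x = 2 * inner ℝ (ψ x) (rad ψ x) := by
  unfold gd; simp

theorem rad_unit {N : ℕ} (ψ : 𝓢(EuclideanSpace ℝ (Fin N), ℂ)) :
    Integrable (fun x => ‖ψ x‖ ^ 2) ∧ Integrable (fun x => inner ℝ (ψ x) (rad ψ x)) ∧
    ∫ x, inner ℝ (ψ x) (rad ψ x) = -(N / 2) * ∫ x, ‖ψ x‖ ^ 2 := by
  have h := rad_one 2 (by norm_num) ψ (fun _ => 1) 0 (by simp) measurable_const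
    (by simpa using hh_int)
  simp only [one_mul, gp_two, gd_two, integral_const_mul] at h
  refine ⟨h.1, ?_, ?_⟩
  · have := h.2.1.const_mul (1/2)
    refine this.congr (Filter.Eventually.of_forall fun x => ?_)
    simp only; ring
  · have := h.2.2
    linarith

theorem rad_inv_sq {N : ℕ} (hN : 3 ≤ N) (ψ : 𝓢(EuclideanSpace ℝ (Fin N), ℂ)) :
    Integrable (fun x => ‖ψ x‖ ^ 2 / ‖x‖ ^ 2) ∧
    Integrable (fun x => inner ℝ (ψ x) (rad ψ x) / ‖x‖ ^ 2) ∧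
    ∫ x, inner ℝ (ψ x) (rad ψ x) / ‖x‖ ^ 2 = -((N - 2) / 2) * ∫ x, ‖ψ x‖ ^ 2 / ‖x‖ ^ 2 := by
  have hN' : (3:ℝ) ≤ N := by exact_mod_cast hN
  have h := rad_one 2 (by norm_num) ψ (fun x => ‖x‖ ^ (-(2:ℝ))) (-2)
    (fun t ht x => by
      rw [norm_smul, Real.norm_of_nonneg ht.le, Real.mul_rpow ht.le (norm_nonneg _)])
    (norm_rpow_meas _) (int_rpow_hh hN 2 (by norm_num) (by linarith))
  have e : ∀ x : EuclideanSpace ℝ (Fin N), ‖x‖ ^ (-(2:ℝ)) = (‖x‖ ^ 2)⁻¹ := fun x => by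
    rw [Real.rpow_neg (norm_nonneg _)]; norm_cast
  simp only [gp_two, gd_two, e] at h
  have e1 : ∀ x, (‖x‖ ^ 2)⁻¹ * ‖ψ x‖ ^ 2 = ‖ψ x‖ ^ 2 / ‖x‖ ^ 2 := fun x => by
    rw [div_eq_mul_inv, mul_comm]
  have e2 : ∀ x, (‖x‖ ^ 2)⁻¹ * (2 * inner ℝ (ψ x) (rad ψ x)) =
      2 * (inner ℝ (ψ x) (rad ψ x) / ‖x‖ ^ 2) := fun x => by
    rw [div_eq_mul_inv]; ring
  simp only [e1, e2, integral_const_mul] at h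
  refine ⟨h.1, ?_, ?_⟩
  · have := h.2.1.const_mul (1/2)
    refine this.congr (Filter.Eventually.of_forall fun x => ?_)
    simp only; ring
  · have := h.2.2
    linarith

theorem int_gradNormSq {N : ℕ} (ψ : 𝓢(EuclideanSpace ℝ (Fin N), ℂ)) :
    ∫ x, gradNormSq ψ x = ∑ i, ∫ x, ‖fderiv ℝ ψ x (EuclideanSpace.single i 1)‖ ^ 2 := by
  unfold gradNormSq
  exact integral_finsetSum _ (fun i _ => (rad_unit (∂_{EuclideanSpace.single i (1:ℝ)} ψ)).1)

theorem ibp_self {N : ℕ} (ψ : 𝓢(EuclideanSpace ℝ (Fin N), ℂ)) :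
    ∫ x, inner ℝ (lap ψ x) (ψ x) = - ∫ x, gradNormSq ψ x := by
  rw [ibp, int_gradNormSq]
  simp only [real_inner_self_eq_norm_sq]

theorem ibp_rad {N : ℕ} (ψ : 𝓢(EuclideanSpace ℝ (Fin N), ℂ)) :
    ∫ x, inner ℝ (lap ψ x) (rad ψ x) = ((N:ℝ) / 2 - 1) * ∫ x, gradNormSq ψ x := by
  rw [ibp, int_gradNormSq, ← Finset.sum_neg_distrib, Finset.mul_sum]
  refine Finset.sum_congr rfl fun i _ => ?_
  have h := rad_unit (∂_{EuclideanSpace.single i (1:ℝ)} ψ)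
  simp only [fderiv_rad, inner_add_right, real_inner_self_eq_norm_sq]
  have h1 : ∫ x, (inner ℝ (fderiv ℝ ψ x (EuclideanSpace.single i 1))
      (rad (∂_{EuclideanSpace.single i (1:ℝ)} ψ) x) +
      ‖fderiv ℝ ψ x (EuclideanSpace.single i 1)‖ ^ 2) = _ := integral_add h.2.1 h.1
  have h2 : ∫ x, inner ℝ (fderiv ℝ ψ x (EuclideanSpace.single i 1))
      (rad (∂_{EuclideanSpace.single i (1:ℝ)} ψ) x) =
      -((N:ℝ) / 2) * ∫ x, ‖fderiv ℝ ψ x (EuclideanSpace.single i 1)‖ ^ 2 := h.2.2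
  rw [h1, h2]
  ring

theorem lap_int {N : ℕ} (ψ χ : 𝓢(EuclideanSpace ℝ (Fin N), ℂ)) :
    Integrable (fun x => inner ℝ (lap ψ x) (χ x)) := by
  have e : ∀ x, inner ℝ (lap ψ x) (χ x) =
      ∑ i : Fin N, inner ℝ ((∂_{EuclideanSpace.single i (1:ℝ)} (∂_{EuclideanSpace.single i (1:ℝ)} ψ :
        𝓢(EuclideanSpace ℝ (Fin N), ℂ)) : 𝓢(EuclideanSpace ℝ (Fin N), ℂ)) x) (χ x) := by
    intro x
    rw [← sum_inner]
    rfl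
  simp_rw [e]
  exact integrable_finsetSum _ fun i _ => (SchwartzMap.pairing (innerSL ℝ) _ χ).integrable

/-- Testing the equation against a Schwartz function. -/
theorem test_eq {N : ℕ} (hN : 3 ≤ N) (lam : ℝ) (φ χ : 𝓢(EuclideanSpace ℝ (Fin N), ℂ))
    (F : EuclideanSpace ℝ (Fin N) → ℝ)
    (heq : ∀ x : EuclideanSpace ℝ (Fin N), x ≠ 0 →
      -lap (⇑φ) x + (lam / ‖x‖ ^ 2) • φ x + φ x = F x • φ x)
    (h1 : Integrable (fun x => inner ℝ (φ x) (χ x)))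
    (h2 : Integrable (fun x => inner ℝ (φ x) (χ x) / ‖x‖ ^ 2)) :
    -(∫ x, inner ℝ (lap φ x) (χ x)) + lam * (∫ x, inner ℝ (φ x) (χ x) / ‖x‖ ^ 2) +
      ∫ x, inner ℝ (φ x) (χ x) = ∫ x, F x * inner ℝ (φ x) (χ x) := by
  have : Nontrivial (EuclideanSpace ℝ (Fin N)) := by
    apply Module.nontrivial_of_finrank_pos (R := ℝ)
    simp; omega
  have hl := lap_int φ χ
  have hl' : Integrable (fun x => -inner ℝ (lap φ x) (χ x)) := hl.neg
  have hl2 : Integrable (fun x => -inner ℝ (lap φ x) (χ x) +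
      lam * (inner ℝ (φ x) (χ x) / ‖x‖ ^ 2)) := hl'.add (h2.const_mul lam)
  rw [← integral_neg, ← integral_const_mul, ← integral_add hl' (h2.const_mul lam),
    ← integral_add hl2 h1]
  refine integral_congr_ae ?_
  have hz : ∀ᵐ x : EuclideanSpace ℝ (Fin N), x ≠ 0 := by
    simp [ae_iff]
  filter_upwards [hz] with x hx
  have := congrArg (fun y => inner ℝ y (χ x)) (heq x hx)
  simp only [inner_add_left, inner_neg_left, real_inner_smul_left] at this
  rw [← this]
  ring

/-- **Pohozaev identities for the Hartree ground-state equation with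
inverse-square potential.** -/
theorem pohozaev_hartree (N : ℕ) (hN : 3 ≤ N) (α τ lam p B A : ℝ)
    (hα : 0 < α) (hαN : α < N) (hlam : -(((N : ℝ) - 2) ^ 2 / 4) < lam)
    (hτ : 0 < τ) (hτN : τ < N) (hcnd : 0 < 2 - 2 * τ + α)
    (hp1 : 1 + α / N < p) (hp2 : p < 1 + (2 - 2 * τ + α) / ((N : ℝ) - 2))
    (hB : B = N * p - N - α + 2 * τ) (hA : A = 2 * p - B)
    (φ : SchwartzMap (EuclideanSpace ℝ (Fin N)) ℂ) (hφ : φ ≠ 0)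
    (heq : ∀ x : EuclideanSpace ℝ (Fin N), x ≠ 0 →
      -lap (⇑φ) x + (lam / ‖x‖ ^ 2) • φ x + φ x =
        (‖x‖ ^ (-τ) * ‖φ x‖ ^ (p - 2) *
          rieszConvR α (fun y => ‖y‖ ^ (-τ) * ‖φ y‖ ^ p) x) • φ x) :
    hartreeP α τ p ⇑φ = (2 * p / A) * (∫ x, ‖φ x‖ ^ 2) ∧
    hartreeP α τ p ⇑φ = (2 * p / B) * kineticK lam ⇑φ := by
  have hN' : (3:ℝ) ≤ N := by exact_mod_cast hN
  have hp : 1 < p := by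
    have : 0 < α / N := by positivity
    linarith
  have hBpos : 0 < B := by
    have : α / N < p - 1 := by linarith
    rw [div_lt_iff₀ (by linarith)] at this
    nlinarith
  have hApos : 0 < A := by
    have : p - 1 < (2 - 2 * τ + α) / ((N : ℝ) - 2) := by linarith
    rw [lt_div_iff₀ (by linarith)] at this
    nlinarith
  obtain ⟨I1, I2, hD⟩ := rad_two hN τ α hα hαN hτ hτN (by linarith) p hp φ
  obtain ⟨u1, u2, u3⟩ := rad_unit φ
  obtain ⟨v1, v2, v3⟩ := rad_inv_sq hN φ
  have T1 := test_eq hN lam φ φ _ heq (by simpa only [real_inner_self_eq_norm_sq] using u1)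
    (by simpa only [real_inner_self_eq_norm_sq] using v1)
  have T2 := test_eq hN lam φ (rad φ) _ heq u2 v2
  simp only [real_inner_self_eq_norm_sq] at T1
  rw [ibp_self] at T1
  rw [ibp_rad, u3, v3] at T2
  have F1 := fubini_pair τ α (rieszConst N α) _ _ I1
  have F2 := fubini_pair τ α (rieszConst N α) _ _ I2
  have R1 : ∫ x, (‖x‖ ^ (-τ) * ‖φ x‖ ^ (p - 2) *
      rieszConvR α (fun y => ‖y‖ ^ (-τ) * ‖φ y‖ ^ p) x) * ‖φ x‖ ^ 2 = hartreeP α τ p φ := by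
    unfold hartreeP
    refine integral_congr_ae (Filter.Eventually.of_forall fun x => ?_)
    have : ‖φ x‖ ^ (p - 2) * ‖φ x‖ ^ 2 = ‖φ x‖ ^ p := by
      rw [← Real.rpow_add_natCast' (norm_nonneg _) (by push_cast; linarith)]
      congr 1; push_cast; ring
    simp only
    rw [← this]; ring
  have R2 : p * ∫ x, (‖x‖ ^ (-τ) * ‖φ x‖ ^ (p - 2) *
      rieszConvR α (fun y => ‖y‖ ^ (-τ) * ‖φ y‖ ^ p) x) * inner ℝ (φ x) (rad φ x) =
      rieszConst N α * ∫ z, WW N τ α z * (gd p φ z.1 * gp p φ z.2) ∂(volume.prod volume) := by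
    rw [← F2, ← integral_const_mul]
    refine integral_congr_ae (Filter.Eventually.of_forall fun x => ?_)
    simp only [rieszConvR, gd, gp]
    ring
  have F1' : hartreeP α τ p φ = rieszConst N α *
      ∫ z, WW N τ α z * (gp p φ z.1 * gp p φ z.2) ∂(volume.prod volume) := F1
  rw [R1] at T1
  unfold kineticK
  set P := hartreeP α τ p φ
  set M := ∫ x, ‖φ x‖ ^ 2
  set H := ∫ x, ‖φ x‖ ^ 2 / ‖x‖ ^ 2
  set Gr := ∫ x, gradNormSq φ x
  set c := rieszConst N α
  set Q := ∫ z, WW N τ α z * (gp p φ z.1 * gp p φ z.2) ∂(volume.prod volume)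
  set D := ∫ z, WW N τ α z * (gd p φ z.1 * gp p φ z.2) ∂(volume.prod volume)
  rw [← T2] at R2
  have hcD : 2 * (c * D) = -(N + α - 2 * τ) * P := by
    rw [F1', ← mul_assoc, mul_comm 2 c, mul_assoc, hD]; ring
  rw [← R2] at hcD
  have hAP : A * P = 2 * p * M := by
    rw [hA, hB]
    linear_combination (p * (N - 2)) * T1 + hcD
  constructor
  · field_simp
    linarith
  · field_simp
    have : B = 2 * p - A := by linarith
    rw [this]
    linear_combination (-2 * p) * T1 - hAP
end

section
/- (Pohozaev identities for the local ground-state equation with inverse-square potential.) Let N ≥ 3, λ > −(N−2)²/4, 0 < τ < 1, and 1 < q < 1 + (2 − 2τ)/(N−2). Set B' := Nq − N + 2τ and A' := 2q − B'. Suppose ψ : ℝ^N → ℂ is a nonzero Schwartz function that satisfies, for every x ∈ ℝ^N with x ≠ 0, the equation −Δψ(x) + λ ψ(x)/|x|² + ψ(x) = |x|^{−2τ} |ψ(x)|^{2(q−1)} ψ(x). Then Q[ψ] = (2q/A') ‖ψ‖² and Q[ψ] = (2q/B') ‖√K_λ ψ‖². -/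
open MeasureTheory

/-- The weighted potential energy `Q[u] = ∫ |x|^{-2τ} |u(x)|^{2q} dx`. -/
noncomputable def potQ {N : ℕ} (τ q : ℝ) (v : EuclideanSpace ℝ (Fin N) → ℂ) : ℝ :=
  ∫ x, ‖x‖ ^ (-(2 * τ)) * ‖v x‖ ^ (2 * q)

lemma poho_integrable_radial (N : ℕ) (hN : 3 ≤ N) (a : ℝ) (ha0 : 0 ≤ a) (haN : a < N) :
    Integrable (fun x : EuclideanSpace ℝ (Fin N) => ‖x‖ ^ (-a) * ((1 + ‖x‖) ^ (N + 1))⁻¹) := by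
  have : Nonempty (Fin N) := ⟨⟨0, by omega⟩⟩
  have key := integrable_fun_norm_addHaar (E := EuclideanSpace ℝ (Fin N)) (F := ℝ) volume
    (f := fun y => y ^ (-a) * ((1 + y) ^ (N + 1))⁻¹)
  refine key.2 ?_
  rw [finrank_euclideanSpace, Fintype.card_fin]
  have hmeas : Measurable (fun y : ℝ => y ^ (N - 1) • (y ^ (-a) * ((1 + y) ^ (N + 1))⁻¹)) := by
    fun_prop
  rw [← Set.Ioc_union_Ioi_eq_Ioi (zero_le_one' ℝ)]
  refine IntegrableOn.union ?_ ?_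
  · have h1 : IntegrableOn (fun y : ℝ => y ^ ((N : ℝ) - 1 - a)) (Set.Ioc 0 1) := by
      rw [← intervalIntegrable_iff_integrableOn_Ioc_of_le zero_le_one]
      exact intervalIntegral.intervalIntegrable_rpow' (by linarith)
    refine Integrable.mono' h1 hmeas.aestronglyMeasurable ?_
    filter_upwards [ae_restrict_mem measurableSet_Ioc] with y hy
    have hy0 : 0 < y := hy.1
    have e : y ^ ((N : ℝ) - 1 - a) = y ^ (N - 1) * y ^ (-a) := by
      rw [← Real.rpow_natCast, ← Real.rpow_add hy0, Nat.cast_sub (by omega)]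
      simp [sub_eq_add_neg]
    rw [e, Real.norm_of_nonneg (by positivity), smul_eq_mul, ← mul_assoc]
    refine mul_le_of_le_one_right (by positivity) ?_
    exact inv_le_one_of_one_le₀ (one_le_pow₀ (by linarith))
  · have h1 : IntegrableOn (fun y : ℝ => y ^ (-2 : ℝ)) (Set.Ioi 1) :=
      integrableOn_Ioi_rpow_of_lt (by norm_num) one_pos
    refine Integrable.mono' h1 hmeas.aestronglyMeasurable ?_
    filter_upwards [ae_restrict_mem measurableSet_Ioi] with y hy
    have hy1 : 1 < y := hy
    have hy0 : 0 < y := by linarith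
    have e : y ^ (-2 : ℝ) = y ^ (N - 1) * (y ^ (N + 1))⁻¹ := by
      have : N + 1 = N - 1 + 2 := by omega
      rw [this, pow_add, mul_inv, ← mul_assoc, mul_inv_cancel₀ (by positivity), one_mul,
        Real.rpow_neg hy0.le]
      norm_num
    rw [e, Real.norm_of_nonneg (by positivity), smul_eq_mul]
    gcongr
    calc y ^ (-a) * ((1 + y) ^ (N + 1))⁻¹ ≤ 1 * (y ^ (N + 1))⁻¹ := by
          gcongr
          · exact Real.rpow_le_one_of_one_le_of_nonpos hy1.le (by linarith)
          · linarith
      _ = _ := one_mul _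

lemma poho_integrable (N : ℕ) (hN : 3 ≤ N) (a : ℝ) (ha0 : 0 ≤ a) (haN : a < N)
    (F : EuclideanSpace ℝ (Fin N) → ℝ) (hF : Continuous F) (C : ℝ)
    (hC : ∀ x, |F x| ≤ C * ((1 + ‖x‖) ^ (N + 1))⁻¹) :
    Integrable (fun x : EuclideanSpace ℝ (Fin N) => ‖x‖ ^ (-a) * F x) := by
  refine Integrable.mono' ((poho_integrable_radial N hN a ha0 haN).const_mul C) ?_ ?_
  · exact ((measurable_norm.pow_const _).mul hF.measurable).aestronglyMeasurable
  · refine Filter.Eventually.of_forall fun x => ?_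
    rw [norm_mul, Real.norm_of_nonneg (by positivity), Real.norm_eq_abs]
    calc _ ≤ ‖x‖ ^ (-a) * (C * ((1 + ‖x‖) ^ (N + 1))⁻¹) := by gcongr; exact hC x
      _ = _ := by ring

lemma poho_scaling (N : ℕ) (hN : 3 ≤ N) (a : ℝ) (ha0 : 0 ≤ a) (haN : a < N)
    (F : EuclideanSpace ℝ (Fin N) → ℝ) (F' : EuclideanSpace ℝ (Fin N) → EuclideanSpace ℝ (Fin N) →L[ℝ] ℝ)
    (hF : ∀ x, HasFDerivAt F (F' x) x) (hF' : Continuous (fun x => F' x x)) (C : ℝ)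
    (hC : ∀ x, |F x| ≤ C * ((1 + ‖x‖) ^ (N + 1))⁻¹)
    (hC' : ∀ x, |F' x x| ≤ C * ((1 + ‖x‖) ^ (N + 1))⁻¹) :
    ∫ x, ‖x‖ ^ (-a) * F' x x = -(N - a) * ∫ x, ‖x‖ ^ (-a) * F x := by
  have hFc : Continuous F := continuous_iff_continuousAt.2 fun x => (hF x).continuousAt
  have hC0 : 0 ≤ C := by simpa using (abs_nonneg _).trans (hC 0)
  have hd := (hasDerivAt_integral_of_dominated_loc_of_deriv_le (μ := volume) (𝕜 := ℝ) (E := ℝ)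
    (x₀ := 1) (s := Set.Ioo (1/2) (3/2))
    (F := fun s (x : EuclideanSpace ℝ (Fin N)) => ‖x‖ ^ (-a) * F (s • x))
    (F' := fun s x => ‖x‖ ^ (-a) * F' (s • x) x)
    (bound := fun x => (2 * C * 2 ^ (N + 1)) * (‖x‖ ^ (-a) * ((1 + ‖x‖) ^ (N + 1))⁻¹))
    (Ioo_mem_nhds (by norm_num) (by norm_num)) ?_ ?_ ?_ ?_ ?_ ?_).2
  · have h2 : HasDerivAt (fun s : ℝ => s ^ (a - N) * ∫ x, ‖x‖ ^ (-a) * F x)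
        ((a - N) * ∫ x, ‖x‖ ^ (-a) * F x) 1 := by
      have := (Real.hasDerivAt_rpow_const (x := 1) (p := a - N) (Or.inl one_ne_zero)).mul_const
        (∫ x, ‖x‖ ^ (-a) * F x)
      simpa using this
    have h3 : (fun s : ℝ => ∫ x : EuclideanSpace ℝ (Fin N), ‖x‖ ^ (-a) * F (s • x)) =ᶠ[nhds 1]
        (fun s : ℝ => s ^ (a - N) * ∫ x, ‖x‖ ^ (-a) * F x) := by
      filter_upwards [Ioi_mem_nhds (zero_lt_one' ℝ)] with s hs
      have hs0 : 0 < s := hs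
      have e : ∀ x : EuclideanSpace ℝ (Fin N), ‖x‖ ^ (-a) * F (s • x) =
          s ^ a * (fun y => ‖y‖ ^ (-a) * F y) (s • x) := by
        intro x
        simp only [norm_smul, Real.norm_of_nonneg hs0.le]
        rw [Real.mul_rpow hs0.le (norm_nonneg _), Real.rpow_neg hs0.le]
        have : s ^ a ≠ 0 := by positivity
        field_simp
      rw [integral_congr_ae (Filter.Eventually.of_forall e), integral_const_mul, Measure.integral_comp_smul_of_nonneg volume
          (fun y => ‖y‖ ^ (-a) * F y) s (hR := hs0.le),
        finrank_euclideanSpace, Fintype.card_fin, smul_eq_mul, ← mul_assoc, Real.rpow_sub hs0,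
        Real.rpow_natCast, div_eq_mul_inv]
    have := hd.unique (h2.congr_of_eventuallyEq h3)
    simp only [one_smul] at this
    rw [this]; ring
  · refine Filter.Eventually.of_forall fun s => ?_
    have : Continuous fun x : EuclideanSpace ℝ (Fin N) => F (s • x) := by fun_prop
    exact ((measurable_norm.pow_const _).mul this.measurable).aestronglyMeasurable
  · simpa using poho_integrable N hN a ha0 haN F hFc C hC
  · simp only [one_smul]
    exact ((measurable_norm.pow_const _).mul hF'.measurable).aestronglyMeasurable
  · refine Filter.Eventually.of_forall fun x s hs => ?_
    have hs0 : 0 < s := by linarith [hs.1]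
    have e : F' (s • x) x = s⁻¹ * F' (s • x) (s • x) := by
      rw [map_smul, smul_eq_mul, ← mul_assoc, inv_mul_cancel₀ hs0.ne', one_mul]
    have h1 := hC' (s • x)
    have h2 : ((1 + ‖s • x‖) ^ (N + 1))⁻¹ ≤ 2 ^ (N + 1) * ((1 + ‖x‖) ^ (N + 1))⁻¹ := by
      have : (1 + ‖x‖) / 2 ≤ 1 + ‖s • x‖ := by
        rw [norm_smul, Real.norm_of_nonneg hs0.le]
        nlinarith [norm_nonneg x, hs.1]
      calc ((1 + ‖s • x‖) ^ (N + 1))⁻¹ ≤ (((1 + ‖x‖) / 2) ^ (N + 1))⁻¹ := by gcongr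
        _ = _ := by rw [div_pow, inv_div, div_eq_mul_inv]
    have h3 : s⁻¹ ≤ 2 := by
      rw [inv_le_comm₀ hs0 two_pos]; linarith [hs.1]
    rw [norm_mul, Real.norm_of_nonneg (by positivity), Real.norm_eq_abs, e, abs_mul,
      abs_of_pos (inv_pos.2 hs0)]
    calc _ ≤ ‖x‖ ^ (-a) * (2 * (C * (2 ^ (N + 1) * ((1 + ‖x‖) ^ (N + 1))⁻¹))) := by
          gcongr
          exact h1.trans (by gcongr)
      _ = _ := by ring
  · exact (poho_integrable_radial N hN a ha0 haN).const_mul _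
  · refine Filter.Eventually.of_forall fun x s hs => ?_
    have h := (hF (s • x)).comp_hasDerivAt s ((hasDerivAt_id s).smul_const x)
    simpa using h.const_mul (‖x‖ ^ (-a))

lemma poho_decay (N : ℕ) {V : Type*} [NormedAddCommGroup V] [NormedSpace ℝ V]
    (f : SchwartzMap (EuclideanSpace ℝ (Fin N)) V) :
    ∃ C, 0 ≤ C ∧ ∀ x, ‖f x‖ ≤ C * ((1 + ‖x‖) ^ (N + 1))⁻¹ := by
  refine ⟨2 ^ (N + 1) * (Finset.Iic ((N + 1, 0) : ℕ × ℕ)).sup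
    (fun m => SchwartzMap.seminorm ℝ m.1 m.2) f, by positivity, fun x => ?_⟩
  have := SchwartzMap.one_add_le_sup_seminorm_apply (𝕜 := ℝ) (m := (N + 1, 0)) (le_refl (N + 1))
    (le_refl 0) f x
  rw [norm_iteratedFDeriv_zero] at this
  rw [← div_eq_mul_inv, le_div_iff₀ (by positivity), mul_comm]
  exact this

/-- The Schwartz function `x ↦ f'(x) x`. -/
noncomputable def pohoP {N : ℕ} (f : SchwartzMap (EuclideanSpace ℝ (Fin N)) ℂ) :
    SchwartzMap (EuclideanSpace ℝ (Fin N)) ℂ :=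
  SchwartzMap.bilinLeftCLM (ContinuousLinearMap.id ℝ (EuclideanSpace ℝ (Fin N) →L[ℝ] ℂ))
    (g := fun x => x) (by fun_prop)
    (SchwartzMap.fderivCLM ℝ (EuclideanSpace ℝ (Fin N)) ℂ f)

lemma pohoP_apply {N : ℕ} (f : SchwartzMap (EuclideanSpace ℝ (Fin N)) ℂ)
    (x : EuclideanSpace ℝ (Fin N)) : pohoP f x = fderiv ℝ f x x := rfl

lemma poho_pow_bound (p : ℝ) (hp : 2 ≤ p) {B t : ℝ} (ht : 0 ≤ t) (htB : t ≤ B) :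
    t ^ p ≤ B ^ (p - 1) * t ∧ t ^ (p - 2) * t ≤ B ^ (p - 1) := by
  have h : t ^ (p - 1) = t ^ (p - 2) * t := by
    rcases ht.eq_or_lt with h0 | h0
    · subst h0; rw [Real.zero_rpow (by linarith)]; simp
    · rw [← Real.rpow_add_one h0.ne']; ring_nf
  have h' : t ^ p = t ^ (p - 1) * t := by
    rcases ht.eq_or_lt with h0 | h0
    · subst h0; rw [Real.zero_rpow (by linarith)]; simp
    · rw [← Real.rpow_add_one h0.ne']; ring_nf
  have h2 : t ^ (p - 1) ≤ B ^ (p - 1) := Real.rpow_le_rpow ht htB (by linarith)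
  exact ⟨by rw [h']; gcongr, by rw [← h]; exact h2⟩

lemma poho_virial (N : ℕ) (hN : 3 ≤ N) (a : ℝ) (ha0 : 0 ≤ a) (haN : a < N) (p : ℝ) (hp : 2 ≤ p)
    (f : SchwartzMap (EuclideanSpace ℝ (Fin N)) ℂ) :
    Integrable (fun x => ‖x‖ ^ (-a) * ‖f x‖ ^ p) ∧
    Integrable (fun x => ‖x‖ ^ (-a) * (‖f x‖ ^ (p - 2) * inner ℝ (f x) (pohoP f x))) ∧
    p * ∫ x, ‖x‖ ^ (-a) * (‖f x‖ ^ (p - 2) * inner ℝ (f x) (pohoP f x)) =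
      -(N - a) * ∫ x, ‖x‖ ^ (-a) * ‖f x‖ ^ p := by
  obtain ⟨C1, hC1, h1⟩ := poho_decay N f
  obtain ⟨C2, hC2, h2⟩ := poho_decay N (pohoP f)
  have hB : ∀ x, ‖f x‖ ≤ C1 := fun x => (h1 x).trans
    (mul_le_of_le_one_right hC1 (inv_le_one_of_one_le₀
      (one_le_pow₀ (by linarith [norm_nonneg x]))))
  have c1 : Continuous fun x => ‖f x‖ ^ p :=
    f.continuous.norm.rpow_const fun _ => Or.inr (by linarith)
  have c2 : Continuous fun x => ‖f x‖ ^ (p - 2) * inner ℝ (f x) (pohoP f x) :=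
    (f.continuous.norm.rpow_const fun _ => Or.inr (by linarith)).mul
      (f.continuous.inner (pohoP f).continuous)
  have b1 : ∀ x, |‖f x‖ ^ p| ≤ (C1 ^ (p - 1) * C1) * ((1 + ‖x‖) ^ (N + 1))⁻¹ := by
    intro x
    rw [abs_of_nonneg (by positivity), mul_assoc]
    exact (poho_pow_bound p hp (norm_nonneg _) (hB x)).1.trans (by gcongr; exact h1 x)
  have b2 : ∀ x, |‖f x‖ ^ (p - 2) * inner ℝ (f x) (pohoP f x)| ≤
      (C1 ^ (p - 1) * C2) * ((1 + ‖x‖) ^ (N + 1))⁻¹ := by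
    intro x
    rw [abs_mul, abs_of_nonneg (by positivity), mul_assoc]
    calc _ ≤ ‖f x‖ ^ (p - 2) * (‖f x‖ * ‖pohoP f x‖) := by
          gcongr; exact abs_real_inner_le_norm _ _
      _ = (‖f x‖ ^ (p - 2) * ‖f x‖) * ‖pohoP f x‖ := by ring
      _ ≤ _ := by
          gcongr
          · exact (poho_pow_bound p hp (norm_nonneg _) (hB x)).2
          · exact h2 x
  refine ⟨poho_integrable N hN a ha0 haN _ c1 _ b1, poho_integrable N hN a ha0 haN _ c2 _ b2, ?_⟩
  set D := max (C1 ^ (p - 1) * C1) (p * (C1 ^ (p - 1) * C2))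
  have hs := poho_scaling N hN a ha0 haN (fun x => ‖f x‖ ^ p)
    (fun x => (p * ‖f x‖ ^ (p - 2)) • (innerSL ℝ (f x)).comp (fderiv ℝ f x))
    (fun x => (hasFDerivAt_norm_rpow (f x) (by linarith)).comp x f.differentiableAt.hasFDerivAt)
    (by
      have := c2.const_mul p
      convert this using 2 with x
      simp [pohoP_apply, mul_assoc]) D
    (fun x => (b1 x).trans (by gcongr; exact le_max_left _ _))
    (fun x => by
      have e : ((p * ‖f x‖ ^ (p - 2)) • (innerSL ℝ (f x)).comp (fderiv ℝ f x)) x =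
        p * (‖f x‖ ^ (p - 2) * inner ℝ (f x) (pohoP f x)) := by simp [pohoP_apply, mul_assoc]
      rw [e, abs_mul, abs_of_nonneg (by linarith)]
      calc _ ≤ p * ((C1 ^ (p - 1) * C2) * ((1 + ‖x‖) ^ (N + 1))⁻¹) := by gcongr; exact b2 x
        _ = (p * (C1 ^ (p - 1) * C2)) * ((1 + ‖x‖) ^ (N + 1))⁻¹ := by ring
        _ ≤ _ := by gcongr; exact le_max_right _ _)
  rw [← hs, ← integral_const_mul]
  congr 1
  ext x
  simp [pohoP_apply]
  ring

open LineDeriv in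
lemma pohoP_deriv {N : ℕ} (f : SchwartzMap (EuclideanSpace ℝ (Fin N)) ℂ)
    (v x : EuclideanSpace ℝ (Fin N)) :
    (∂_{v} (pohoP f)) x = (∂_{v} f) x + pohoP (∂_{v} f) x := by
  have hc : ContDiff ℝ 2 f := f.smooth 2
  have hd : DifferentiableAt ℝ (fderiv ℝ f) x :=
    ((hc.fderiv_right (m := 1) (by norm_num)).differentiable (by norm_num)) x
  have hP : HasFDerivAt (pohoP f) _ x := hd.hasFDerivAt.clm_apply (hasFDerivAt_id x)
  have hv : HasFDerivAt (∂_{v} f : SchwartzMap _ _) _ x :=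
    (hd.hasFDerivAt.clm_apply (hasFDerivAt_const v x)).congr_of_eventuallyEq
      (Filter.Eventually.of_forall fun y => SchwartzMap.lineDerivOp_apply_eq_fderiv v f y)
  have hsymm := (hc.contDiffAt (x := x)).isSymmSndFDerivAt (by simp)
  rw [SchwartzMap.lineDerivOp_apply_eq_fderiv, SchwartzMap.lineDerivOp_apply_eq_fderiv, pohoP_apply,
    hP.fderiv, hv.fderiv]
  have := hsymm.eq v x
  simp [this]

open LineDeriv in
lemma poho_ibp {N : ℕ} (f g : SchwartzMap (EuclideanSpace ℝ (Fin N)) ℂ)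
    (v : EuclideanSpace ℝ (Fin N)) :
    Integrable (fun x => (inner ℝ (f x) (g x) : ℝ)) ∧
    ∫ x, (inner ℝ (f x) ((∂_{v} g) x) : ℝ) = -∫ x, (inner ℝ ((∂_{v} f) x) (g x) : ℝ) :=
  ⟨(SchwartzMap.bilinLeftCLM (innerSL ℝ (E := ℂ)) g.hasTemperateGrowth f).integrable,
  SchwartzMap.integral_bilinear_lineDerivOp_right_eq_neg_left f g (innerSL ℝ (E := ℂ)) v⟩

open LineDeriv in
lemma poho_lap {N : ℕ} (f : SchwartzMap (EuclideanSpace ℝ (Fin N)) ℂ)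
    (x : EuclideanSpace ℝ (Fin N)) :
    lap f x = ∑ i : Fin N, (∂_{EuclideanSpace.single i (1 : ℝ)} (∂_{EuclideanSpace.single i (1 : ℝ)} f :
      SchwartzMap (EuclideanSpace ℝ (Fin N)) ℂ) : SchwartzMap (EuclideanSpace ℝ (Fin N)) ℂ) x := by
  unfold lap
  refine Finset.sum_congr rfl fun i _ => ?_
  rw [SchwartzMap.lineDerivOp_apply_eq_fderiv]
  congr 2

open LineDeriv in
lemma poho_lap_integrals (N : ℕ) (hN : 3 ≤ N) (f : SchwartzMap (EuclideanSpace ℝ (Fin N)) ℂ) :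
    Integrable (fun x => (inner ℝ (f x) (lap f x) : ℝ)) ∧
    Integrable (fun x => (inner ℝ (pohoP f x) (lap f x) : ℝ)) ∧
    ∫ x, (inner ℝ (f x) (lap f x) : ℝ) = -∫ x, gradNormSq f x ∧
    ∫ x, (inner ℝ (pohoP f x) (lap f x) : ℝ) = ((N : ℝ) / 2 - 1) * ∫ x, gradNormSq f x := by
  set e : Fin N → EuclideanSpace ℝ (Fin N) := fun i => EuclideanSpace.single i (1 : ℝ) with he
  have hG : ∫ x, gradNormSq f x = ∑ i, ∫ x, ‖(∂_{e i} f) x‖ ^ 2 := by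
    rw [← integral_finsetSum]
    · rfl
    · intro i _
      have := (poho_ibp (∂_{e i} f) (∂_{e i} f) 0).1
      simpa only [real_inner_self_eq_norm_sq] using this
  simp_rw [poho_lap, inner_sum]
  refine ⟨integrable_finsetSum _ fun i _ => (poho_ibp _ _ 0).1,
    integrable_finsetSum _ fun i _ => (poho_ibp _ _ 0).1, ?_, ?_⟩
  · rw [integral_finsetSum _ fun i _ => (poho_ibp _ _ 0).1, hG, ← Finset.sum_neg_distrib]
    refine Finset.sum_congr rfl fun i _ => ?_
    rw [(poho_ibp _ _ _).2]
    simp_rw [real_inner_self_eq_norm_sq]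
    rfl
  · rw [integral_finsetSum _ fun i _ => (poho_ibp _ _ 0).1, hG, Finset.mul_sum]
    refine Finset.sum_congr rfl fun i _ => ?_
    rw [(poho_ibp _ _ _).2]
    simp_rw [pohoP_deriv, inner_add_left]
    rw [integral_add (poho_ibp _ _ 0).1 (poho_ibp _ _ 0).1]
    simp_rw [real_inner_self_eq_norm_sq]
    have hv := (poho_virial N hN 0 le_rfl (by positivity) 2 le_rfl (∂_{e i} f)).2.2
    simp only [neg_zero, Real.rpow_zero, one_mul, sub_self, sub_zero, Real.rpow_two] at hv
    have hc : ∫ x, (inner ℝ (pohoP (∂_{e i} f) x) ((∂_{e i} f) x) : ℝ) =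
        ∫ x, (inner ℝ ((∂_{e i} f) x) (pohoP (∂_{e i} f) x) : ℝ) :=
      integral_congr_ae (Filter.Eventually.of_forall fun x => real_inner_comm _ _)
    simp only [he] at hv hc ⊢
    rw [hc]
    linarith

/-- **Pohozaev identities for the local ground-state equation with
inverse-square potential.** -/
theorem pohozaev_local (N : ℕ) (hN : 3 ≤ N) (τ lam q B' A' : ℝ)
    (hlam : -(((N : ℝ) - 2) ^ 2 / 4) < lam)
    (hτ0 : 0 < τ) (hτ1 : τ < 1)
    (hq1 : 1 < q) (hq2 : q < 1 + (2 - 2 * τ) / ((N : ℝ) - 2))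
    (hB : B' = N * q - N + 2 * τ) (hA : A' = 2 * q - B')
    (ψ : SchwartzMap (EuclideanSpace ℝ (Fin N)) ℂ) (hψ : ψ ≠ 0)
    (heq : ∀ x : EuclideanSpace ℝ (Fin N), x ≠ 0 →
      -lap (⇑ψ) x + (lam / ‖x‖ ^ 2) • ψ x + ψ x =
        (‖x‖ ^ (-(2 * τ)) * ‖ψ x‖ ^ (2 * (q - 1))) • ψ x) :
    potQ τ q ⇑ψ = (2 * q / A') * (∫ x, ‖ψ x‖ ^ 2) ∧
    potQ τ q ⇑ψ = (2 * q / B') * kineticK lam ⇑ψ := by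
  have hN0 : (3 : ℝ) ≤ N := by exact_mod_cast hN
  have hA0 : 0 < A' := by
    have h : q - 1 < (2 - 2 * τ) / ((N : ℝ) - 2) := by linarith
    rw [lt_div_iff₀ (by linarith)] at h
    rw [hA, hB]; nlinarith
  have hB0 : 0 < B' := by
    rw [hB]; nlinarith
  obtain ⟨iM, iM', vM⟩ := poho_virial N hN 0 le_rfl (by linarith) 2 le_rfl ψ
  obtain ⟨iH, iH', vH⟩ := poho_virial N hN 2 (by norm_num) (by linarith) 2 le_rfl ψ
  obtain ⟨iQ, iQ', vQ⟩ := poho_virial N hN (2 * τ) (by linarith) (by linarith) (2 * q)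
    (by linarith) ψ
  obtain ⟨iL, iL', vL, vL'⟩ := poho_lap_integrals N hN ψ
  have hx2 : ∀ x : EuclideanSpace ℝ (Fin N), ‖x‖ ^ (-2 : ℝ) = (‖x‖ ^ 2)⁻¹ := fun x => by
    rw [Real.rpow_neg (norm_nonneg _), Real.rpow_two]
  simp only [neg_zero, Real.rpow_zero, one_mul, sub_self, sub_zero, Real.rpow_two, hx2]
    at iM iM' vM iH iH' vH
  have hae : ∀ᵐ x : EuclideanSpace ℝ (Fin N), x ≠ 0 := by
    have : Nonempty (Fin N) := ⟨⟨0, by omega⟩⟩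
    exact Measure.ae_ne volume 0
  have pair : ∀ (x : EuclideanSpace ℝ (Fin N)), x ≠ 0 → ∀ w : ℂ,
      -(inner ℝ w (lap ψ x) : ℝ) + lam * ((‖x‖ ^ 2)⁻¹ * inner ℝ w (ψ x)) + inner ℝ w (ψ x) =
        ‖x‖ ^ (-(2 * τ)) * (‖ψ x‖ ^ (2 * q - 2) * inner ℝ w (ψ x)) := by
    intro x hx w
    have h := congrArg (fun z => (inner ℝ w z : ℝ)) (heq x hx)
    simp only [inner_add_right, inner_neg_right, inner_smul_right_eq_smul, smul_eq_mul] at h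
    rw [show 2 * q - 2 = 2 * (q - 1) by ring, ← mul_assoc, ← mul_assoc, ← h, div_eq_mul_inv]
  have id1 : -(∫ x, (inner ℝ (ψ x) (lap ψ x) : ℝ)) + lam * (∫ x, (‖x‖ ^ 2)⁻¹ * ‖ψ x‖ ^ 2)
      + ∫ x, ‖ψ x‖ ^ 2 = ∫ x, ‖x‖ ^ (-(2 * τ)) * ‖ψ x‖ ^ (2 * q) := by
    have j1 : Integrable (fun x => -(inner ℝ (ψ x) (lap ψ x) : ℝ)) := iL.neg
    have j2 : Integrable (fun x => lam * ((‖x‖ ^ 2)⁻¹ * ‖ψ x‖ ^ 2)) := iH.const_mul _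
    have j3 : Integrable (fun x => -(inner ℝ (ψ x) (lap ψ x) : ℝ)
      + lam * ((‖x‖ ^ 2)⁻¹ * ‖ψ x‖ ^ 2)) := j1.add j2
    rw [← integral_neg, ← integral_const_mul, ← integral_add j1 j2, ← integral_add j3 iM]
    refine integral_congr_ae ?_
    filter_upwards [hae] with x hx
    have h := pair x hx (ψ x)
    rw [real_inner_self_eq_norm_sq] at h
    rw [h]
    congr 1
    rcases (norm_nonneg (ψ x)).eq_or_lt with h0 | h0
    · rw [← h0, Real.zero_rpow (x := 2 * q) (by linarith)]; simp
    · rw [← Real.rpow_two, ← Real.rpow_add h0]; ring_nf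
  have id2 : -(∫ x, (inner ℝ (pohoP ψ x) (lap ψ x) : ℝ))
      + lam * (∫ x, (‖x‖ ^ 2)⁻¹ * (inner ℝ (ψ x) (pohoP ψ x) : ℝ))
      + ∫ x, (inner ℝ (ψ x) (pohoP ψ x) : ℝ) =
      ∫ x, ‖x‖ ^ (-(2 * τ)) * (‖ψ x‖ ^ (2 * q - 2) * inner ℝ (ψ x) (pohoP ψ x)) := by
    have j1 : Integrable (fun x => -(inner ℝ (pohoP ψ x) (lap ψ x) : ℝ)) := iL'.neg
    have j2 : Integrable (fun x => lam * ((‖x‖ ^ 2)⁻¹ * (inner ℝ (ψ x) (pohoP ψ x) : ℝ))) := iH'.const_mul _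
    have j3 : Integrable (fun x => -(inner ℝ (pohoP ψ x) (lap ψ x) : ℝ)
      + lam * ((‖x‖ ^ 2)⁻¹ * (inner ℝ (ψ x) (pohoP ψ x) : ℝ))) := j1.add j2
    rw [← integral_neg, ← integral_const_mul, ← integral_add j1 j2, ← integral_add j3 iM']
    refine integral_congr_ae ?_
    filter_upwards [hae] with x hx
    have h := pair x hx (pohoP ψ x)
    rw [real_inner_comm (ψ x) (pohoP ψ x)] at h
    exact h
  have hK : kineticK lam ψ = (∫ x, gradNormSq ψ x) + lam * ∫ x, (‖x‖ ^ 2)⁻¹ * ‖ψ x‖ ^ 2 := by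
    unfold kineticK
    simp_rw [div_eq_inv_mul]
  unfold potQ
  rw [hK]
  rw [vL] at id1
  rw [vL'] at id2
  set Q := ∫ x, ‖x‖ ^ (-(2 * τ)) * ‖ψ x‖ ^ (2 * q)
  set M := ∫ x, ‖ψ x‖ ^ 2
  set H := ∫ x, (‖x‖ ^ 2)⁻¹ * ‖ψ x‖ ^ 2
  set G := ∫ x, gradNormSq ψ x
  set Q' := ∫ x, ‖x‖ ^ (-(2 * τ)) * (‖ψ x‖ ^ (2 * q - 2) * inner ℝ (ψ x) (pohoP ψ x))
  set M' := ∫ x, (inner ℝ (ψ x) (pohoP ψ x) : ℝ)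
  set H' := ∫ x, (‖x‖ ^ 2)⁻¹ * (inner ℝ (ψ x) (pohoP ψ x) : ℝ)
  have hM : A' * Q = 2 * q * M := by
    subst hA hB
    linear_combination 2 * q * id2 + vQ - q * vM - lam * q * vH + ((N : ℝ) - 2) * q * id1
  have hKK : B' * Q = 2 * q * (G + lam * H) := by
    have : B' = 2 * q - A' := by rw [hA]; ring
    rw [this]
    linear_combination -hM - 2 * q * id1
  constructor
  · rw [div_mul_eq_mul_div, eq_div_iff hA0.ne']; linarith
  · rw [div_mul_eq_mul_div, eq_div_iff hB0.ne']; linarith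
end

section
/- (Quantitative negativity of the virial functional below the mountain-pass level, inverse-square potential Hartree case.) Let N ≥ 3, 0 < α < N, λ > −(N−2)²/4, τ > 0 with min{τ, α, N−α, N−τ, 2−2τ+α} > 0, and 1 + α/N < p < 1 + (2 − 2τ + α)/(N−2); set B := Np − N − α + 2τ and assume B > 2. For smooth compactly supported u : ℝ^N → ℂ define I[u] := ‖√K_λ u‖² − (B/(2p)) P[u] and S[u] := ‖√K_λ u‖² + ‖u‖² − (1/p) P[u], and let m := inf { S[v] : v smooth compactly supported, v ≠ 0, I[v] = 0 }. Then for every smooth compactly supported u ≠ 0 with I[u] < 0 one has I[u] ≤ −(B/2)(m − S[u]). -/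
open MeasureTheory

/-- The virial functional `I[u] := ‖√K_λ u‖² − (B/(2p)) P[u]`. -/
noncomputable def virialI {N : ℕ} (α τ lam p B : ℝ)
    (u : EuclideanSpace ℝ (Fin N) → ℂ) : ℝ :=
  kineticK lam u - (B / (2 * p)) * hartreeP α τ p u

/-- The action `S[u] := ‖√K_λ u‖² + ‖u‖² − (1/p) P[u]`. -/
noncomputable def actionS {N : ℕ} (α τ lam p : ℝ)
    (u : EuclideanSpace ℝ (Fin N) → ℂ) : ℝ :=
  kineticK lam u + (∫ x, ‖u x‖ ^ 2) - (1 / p) * hartreeP α τ p u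

/-- The mountain-pass level
`m := inf { S[v] : v smooth compactly supported, v ≠ 0, I[v] = 0 }`. -/
noncomputable def mpLevel (N : ℕ) (α τ lam p B : ℝ) : ℝ :=
  sInf {s : ℝ | ∃ v : EuclideanSpace ℝ (Fin N) → ℂ,
    ContDiff ℝ (⊤ : ℕ∞) v ∧ HasCompactSupport v ∧ v ≠ 0 ∧
    virialI α τ lam p B v = 0 ∧ s = actionS α τ lam p v}

lemma integral_fderiv_apply_eq_zero' {N : ℕ} {g : EuclideanSpace ℝ (Fin N) → ℝ}
    (hg : ContDiff ℝ 1 g) (hc : HasCompactSupport g) (v : EuclideanSpace ℝ (Fin N)) :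
    Integrable (fun x => fderiv ℝ g x v) ∧ ∫ x, fderiv ℝ g x v = 0 := by
  have hi : Integrable (fun x => fderiv ℝ g x v) := by
    apply Continuous.integrable_of_hasCompactSupport
    · exact (hg.continuous_fderiv (by norm_num)).clm_apply continuous_const
    · exact hc.fderiv_apply (𝕜 := ℝ) v
  refine ⟨hi, ?_⟩
  have := integral_mul_fderiv_eq_neg_fderiv_mul_of_integrable (𝕜 := ℝ) (μ := volume)
    (f := fun _ : EuclideanSpace ℝ (Fin N) => (1 : ℝ)) (g := g) (v := v)
    (by simp) (by simpa using hi)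
    (by simpa using hg.continuous.integrable_of_hasCompactSupport hc)
    (fun x _ => by fun_prop) (fun x _ => (hg.differentiable (by norm_num)) x)
  simpa using this

lemma integrable_gradNormSq {N : ℕ} {u : EuclideanSpace ℝ (Fin N) → ℂ}
    (hu : ContDiff ℝ (⊤ : ℕ∞) u) (hc : HasCompactSupport u) :
    Integrable (gradNormSq u) := by
  unfold gradNormSq
  refine integrable_finsetSum _ fun i _ => ?_
  have hcd : Continuous (fun x => fderiv ℝ u x (EuclideanSpace.single i 1)) :=
    (hu.continuous_fderiv (by simp)).clm_apply continuous_const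
  apply Continuous.integrable_of_hasCompactSupport
  · exact hcd.norm.pow 2
  · exact (hc.fderiv_apply (𝕜 := ℝ) (EuclideanSpace.single i 1)).comp_left
      (g := fun z : ℂ => ‖z‖ ^ 2) (by simp)

lemma integrable_sq_div {N : ℕ} (hN : 3 ≤ N) {u : EuclideanSpace ℝ (Fin N) → ℂ}
    (hu : Continuous u) (hc : HasCompactSupport u) :
    Integrable (fun x => ‖u x‖ ^ 2 / ‖x‖ ^ 2) := by
  have : Nontrivial (EuclideanSpace ℝ (Fin N)) := by
    have : Nonempty (Fin N) := ⟨⟨0, by omega⟩⟩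
    infer_instance
  obtain ⟨C, hC⟩ := hc.exists_bound_of_continuous hu
  obtain ⟨R, hR⟩ := hc.isCompact.isBounded.subset_ball (0 : EuclideanSpace ℝ (Fin N))
  have h1 : IntegrableOn (fun x : EuclideanSpace ℝ (Fin N) => (‖x‖ ^ 2)⁻¹)
      (Metric.ball 0 R) := by
    rw [integrableOn_fun_norm_addHaar volume (f := fun y : ℝ => (y ^ 2)⁻¹)]
    have : IntegrableOn (fun y : ℝ => y ^ (N - 3)) (Set.Ioo 0 R) :=
      ((continuous_pow (N - 3)).integrableOn_Icc (a := 0) (b := R)).mono_set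
        Set.Ioo_subset_Icc_self
    refine this.congr_fun ?_ measurableSet_Ioo
    intro y hy
    have hy0 : y ≠ 0 := hy.1.ne'
    obtain ⟨k, rfl⟩ := Nat.exists_eq_add_of_le hN
    have e : 3 + k - 1 = k + 2 := by omega
    simp only [finrank_euclideanSpace, Fintype.card_fin, smul_eq_mul, e]
    rw [show 3 + k - 3 = k by omega]
    field_simp
    ring
  have h2 : IntegrableOn (fun x => ‖u x‖ ^ 2 / ‖x‖ ^ 2) (Metric.ball 0 R) := by
    refine Integrable.mono' (h1.const_mul (C ^ 2)) ?_ ?_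
    · apply Measurable.aestronglyMeasurable
      have := hu.measurable
      fun_prop
    · refine Filter.Eventually.of_forall fun x => ?_
      rw [Real.norm_of_nonneg (by positivity), div_eq_mul_inv]
      gcongr
      exact hC x
  rwa [integrableOn_iff_integrable_of_support_subset] at h2
  intro x hx
  apply hR
  apply subset_tsupport
  intro h
  apply hx
  simp [h]

lemma hardy_eps {N : ℕ} (hN : 3 ≤ N) {u : EuclideanSpace ℝ (Fin N) → ℂ}
    (hu : ContDiff ℝ (⊤ : ℕ∞) u) (hc : HasCompactSupport u) {ε : ℝ} (hε : 0 < ε) :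
    (((N : ℝ) - 2) ^ 2 / 4) * ∫ x, ‖u x‖ ^ 2 * (‖x‖ ^ 2 + ε)⁻¹ ≤ ∫ x, gradNormSq u x := by
  have hN' : (3 : ℝ) ≤ N := by exact_mod_cast hN
  set s : ℝ := ((N : ℝ) - 2) / 2 with hs
  have hs0 : 0 < s := by rw [hs]; linarith
  let g : Fin N → EuclideanSpace ℝ (Fin N) → ℝ := fun i x =>
    ‖u x‖ ^ 2 * (x i * (‖x‖ ^ 2 + ε)⁻¹)
  have hpos : ∀ x : EuclideanSpace ℝ (Fin N), 0 < ‖x‖ ^ 2 + ε := fun x => by positivity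
  have hu1 : ContDiff ℝ 1 u := hu.of_le (by exact_mod_cast le_top)
  have hg : ∀ i, ContDiff ℝ 1 (g i) := by
    intro i
    refine (hu1.norm_sq ℝ).mul (ContDiff.mul ?_ (ContDiff.inv ?_ fun x => (hpos x).ne'))
    · exact (EuclideanSpace.proj (𝕜 := ℝ) i).contDiff
    · exact (contDiff_norm_sq ℝ).add contDiff_const
  have hgc : ∀ i, HasCompactSupport (g i) := by
    intro i
    apply HasCompactSupport.mul_right
    exact hc.comp_left (g := fun z : ℂ => ‖z‖ ^ 2) (by simp)
  have hd : ∀ i x, fderiv ℝ (g i) x (EuclideanSpace.single i 1) =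
      ‖u x‖ ^ 2 * ((‖x‖ ^ 2 + ε)⁻¹ - 2 * x i ^ 2 * ((‖x‖ ^ 2 + ε)⁻¹) ^ 2) +
      2 * inner ℝ (u x) (fderiv ℝ u x (EuclideanSpace.single i 1)) *
        (x i * (‖x‖ ^ 2 + ε)⁻¹) := by
    intro i x
    have d1 : HasFDerivAt u (fderiv ℝ u x) x := (hu1.differentiable (by norm_num) x).hasFDerivAt
    have d2 := d1.norm_sq
    have d3 : HasFDerivAt (fun y : EuclideanSpace ℝ (Fin N) => y i)
      (EuclideanSpace.proj (𝕜 := ℝ) i) x := (EuclideanSpace.proj (𝕜 := ℝ) i).hasFDerivAt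
    have d4 := ((hasFDerivAt_id (𝕜 := ℝ) x).norm_sq).add_const ε
    have d5 := (hasDerivAt_inv (hpos x).ne').comp_hasFDerivAt x d4
    have d6 := d2.mul (d3.mul d5)
    have := congrArg (fun L => L (EuclideanSpace.single i (1 : ℝ))) d6.fderiv
    refine Eq.trans this ?_
    simp [EuclideanSpace.inner_single_right]
    ring
  have key : ∀ x, s ^ 2 * (‖u x‖ ^ 2 * (‖x‖ ^ 2 + ε)⁻¹) ≤
      gradNormSq u x + s * ∑ i, fderiv ℝ (g i) x (EuclideanSpace.single i 1) := by
    intro x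
    simp only [hd]
    unfold gradNormSq
    set w := (‖x‖ ^ 2 + ε)⁻¹ with hw
    have hw0 : 0 < w := inv_pos.2 (hpos x)
    have hw1 : ‖x‖ ^ 2 * w ≤ 1 := by
      rw [hw, ← div_eq_mul_inv, div_le_one (hpos x)]; linarith
    have hr : ‖x‖ ^ 2 = ∑ i, x i ^ 2 := by
      rw [EuclideanSpace.norm_sq_eq]; simp
    have h0 : 0 ≤ ∑ i, ‖fderiv ℝ u x (EuclideanSpace.single i 1) + (s * (x i * w)) • u x‖ ^ 2 :=
      Finset.sum_nonneg fun i _ => by positivity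
    have h1 : ∑ i, ‖fderiv ℝ u x (EuclideanSpace.single i 1) + (s * (x i * w)) • u x‖ ^ 2
        = (∑ i, ‖fderiv ℝ u x (EuclideanSpace.single i 1)‖ ^ 2) + s * (∑ i,
          2 * inner ℝ (u x) (fderiv ℝ u x (EuclideanSpace.single i 1)) * (x i * w))
          + s ^ 2 * w ^ 2 * ‖u x‖ ^ 2 * ‖x‖ ^ 2 := by
      rw [hr, Finset.mul_sum, Finset.mul_sum, ← Finset.sum_add_distrib, ← Finset.sum_add_distrib]
      refine Finset.sum_congr rfl fun i _ => ?_
      rw [norm_add_sq_real, norm_smul, inner_smul_right, mul_pow, Real.norm_eq_abs, sq_abs,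
        real_inner_comm]
      ring
    have h2 : ∑ i, ‖u x‖ ^ 2 * (w - 2 * x i ^ 2 * w ^ 2)
        = ‖u x‖ ^ 2 * (N * w - 2 * ‖x‖ ^ 2 * w ^ 2) := by
      rw [← Finset.mul_sum, Finset.sum_sub_distrib, ← Finset.sum_mul, ← Finset.mul_sum, ← hr]
      simp
    rw [Finset.sum_add_distrib, h2]
    have h3 : 0 ≤ ‖u x‖ ^ 2 * w * (s ^ 2 + 2 * s) * (1 - ‖x‖ ^ 2 * w) := by
      have : 0 ≤ 1 - ‖x‖ ^ 2 * w := by linarith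
      positivity
    have hNs : (N : ℝ) = 2 * s + 2 := by rw [hs]; ring
    rw [hNs]
    rw [h1] at h0
    nlinarith [h0, h3]
  have i1 := integrable_gradNormSq hu hc
  have i2 : Integrable (fun x => s * ∑ i, fderiv ℝ (g i) x (EuclideanSpace.single i 1)) :=
    (integrable_finsetSum _ fun i _ =>
      (integral_fderiv_apply_eq_zero' (hg i) (hgc i) _).1).const_mul s
  have i3 : Integrable (fun x => ‖u x‖ ^ 2 * (‖x‖ ^ 2 + ε)⁻¹) := by
    apply Continuous.integrable_of_hasCompactSupport
    · exact (hu.continuous.norm.pow 2).mul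
        (Continuous.inv₀ (by fun_prop) fun x => (hpos x).ne')
    · apply HasCompactSupport.mul_right
      exact hc.comp_left (g := fun z : ℂ => ‖z‖ ^ 2) (by simp)
  have := integral_mono (i3.const_mul (s ^ 2)) (i1.add i2) key
  have e : ∫ x, (gradNormSq u + fun x =>
      s * ∑ i, fderiv ℝ (g i) x (EuclideanSpace.single i 1)) x = ∫ x, gradNormSq u x := by
    rw [integral_add' i1 i2, integral_const_mul, integral_finsetSum _ fun i _ =>
      (integral_fderiv_apply_eq_zero' (hg i) (hgc i) _).1]
    simp [fun i => (integral_fderiv_apply_eq_zero' (hg i) (hgc i)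
      (EuclideanSpace.single i (1 : ℝ))).2]
  rw [integral_const_mul] at this
  calc _ = s ^ 2 * ∫ x, ‖u x‖ ^ 2 * (‖x‖ ^ 2 + ε)⁻¹ := by rw [hs]; ring
    _ ≤ _ := this
    _ = _ := e

lemma hardy {N : ℕ} (hN : 3 ≤ N) {u : EuclideanSpace ℝ (Fin N) → ℂ}
    (hu : ContDiff ℝ (⊤ : ℕ∞) u) (hc : HasCompactSupport u) :
    (((N : ℝ) - 2) ^ 2 / 4) * ∫ x, ‖u x‖ ^ 2 / ‖x‖ ^ 2 ≤ ∫ x, gradNormSq u x := by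
  have : Nontrivial (EuclideanSpace ℝ (Fin N)) := by
    have : Nonempty (Fin N) := ⟨⟨0, by omega⟩⟩
    infer_instance
  have hae : ∀ᵐ x : EuclideanSpace ℝ (Fin N), x ≠ 0 := by
    simp [ae_iff]
  have ht : Filter.Tendsto (fun n : ℕ => ∫ x, ‖u x‖ ^ 2 * (‖x‖ ^ 2 + 1 / ((n : ℝ) + 1))⁻¹)
      Filter.atTop (nhds (∫ x, ‖u x‖ ^ 2 / ‖x‖ ^ 2)) := by
    refine tendsto_integral_of_dominated_convergence _ ?_
      (integrable_sq_div hN hu.continuous hc) ?_ ?_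
    · intro n
      apply Measurable.aestronglyMeasurable
      have := hu.continuous.measurable
      fun_prop
    · intro n
      filter_upwards [hae] with x hx
      have hx' : 0 < ‖x‖ := norm_pos_iff.2 hx
      rw [Real.norm_of_nonneg (by positivity), div_eq_mul_inv (‖u x‖ ^ 2)]
      have : (0 : ℝ) ≤ 1 / ((n : ℝ) + 1) := by positivity
      gcongr
      linarith
    · filter_upwards [hae] with x hx
      have hx' : 0 < ‖x‖ := norm_pos_iff.2 hx
      rw [div_eq_mul_inv]
      refine Filter.Tendsto.const_mul _ (Filter.Tendsto.inv₀ ?_ (by positivity))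
      simpa using (tendsto_one_div_add_atTop_nhds_zero_nat (𝕜 := ℝ)).const_add (‖x‖ ^ 2)
  refine le_of_tendsto (ht.const_mul _) (Filter.Eventually.of_forall fun n => ?_)
  exact hardy_eps hN hu hc (by positivity)

lemma kineticK_pos {N : ℕ} (hN : 3 ≤ N) {lam : ℝ} (hlam : -(((N : ℝ) - 2) ^ 2 / 4) < lam)
    {u : EuclideanSpace ℝ (Fin N) → ℂ}
    (hu : ContDiff ℝ (⊤ : ℕ∞) u) (hc : HasCompactSupport u) (hne : u ≠ 0) :
    0 < kineticK lam u := by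
  have : Nontrivial (EuclideanSpace ℝ (Fin N)) := by
    have : Nonempty (Fin N) := ⟨⟨0, by omega⟩⟩
    infer_instance
  have h := hardy hN hu hc
  have hpos : 0 < ∫ x, ‖u x‖ ^ 2 / ‖x‖ ^ 2 := by
    rw [integral_pos_iff_support_of_nonneg (fun x => by positivity)
      (integrable_sq_div hN hu.continuous hc)]
    have e : Function.support (fun x => ‖u x‖ ^ 2 / ‖x‖ ^ 2) = Function.support u \ {0} := by
      ext x; simp
    rw [e, measure_sdiff_null (by simp)]
    exact hu.continuous.isOpen_support.measure_pos _ (Function.support_nonempty_iff.2 hne)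
  unfold kineticK
  nlinarith

/-- the mass-preserving dilation -/
noncomputable def dil {N : ℕ} (ρ : ℝ) (u : EuclideanSpace ℝ (Fin N) → ℂ) :
    EuclideanSpace ℝ (Fin N) → ℂ := fun x => (ρ ^ ((N : ℝ) / 2)) • u (ρ • x)

lemma norm_dil {N : ℕ} {ρ : ℝ} (hρ : 0 < ρ) (u : EuclideanSpace ℝ (Fin N) → ℂ) (x) :
    ‖dil ρ u x‖ = ρ ^ ((N : ℝ) / 2) * ‖u (ρ • x)‖ := by
  unfold dil
  rw [norm_smul, Real.norm_of_nonneg (by positivity)]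

lemma pow_half_sq (N : ℕ) {ρ : ℝ} (hρ : 0 < ρ) : (ρ ^ ((N : ℝ) / 2)) ^ 2 = ρ ^ N := by
  rw [← Real.rpow_natCast, ← Real.rpow_mul hρ.le, ← Real.rpow_natCast]
  congr 1
  push_cast; ring

lemma integral_dil {N : ℕ} {ρ : ℝ} (hρ : 0 < ρ) (f : EuclideanSpace ℝ (Fin N) → ℝ) :
    ∫ x, f (ρ • x) = (ρ ^ N)⁻¹ * ∫ x, f x := by
  rw [Measure.integral_comp_smul_of_nonneg volume f ρ (hR := hρ.le)]
  simp

lemma mass_dil {N : ℕ} {ρ : ℝ} (hρ : 0 < ρ) (u : EuclideanSpace ℝ (Fin N) → ℂ) :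
    ∫ x, ‖dil ρ u x‖ ^ 2 = ∫ x, ‖u x‖ ^ 2 := by
  simp only [norm_dil hρ, mul_pow, pow_half_sq N hρ]
  rw [integral_const_mul, integral_dil hρ (fun x => ‖u x‖ ^ 2)]
  field_simp

lemma kin_dil {N : ℕ} {ρ : ℝ} (hρ : 0 < ρ) (lam : ℝ) {u : EuclideanSpace ℝ (Fin N) → ℂ}
    (hu : ContDiff ℝ (⊤ : ℕ∞) u) :
    kineticK lam (dil ρ u) = ρ ^ 2 * kineticK lam u := by
  have h1 : ∀ x, gradNormSq (dil ρ u) x = ρ ^ N * ρ ^ 2 * gradNormSq u (ρ • x) := by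
    intro x
    unfold gradNormSq
    rw [Finset.mul_sum]
    refine Finset.sum_congr rfl fun i _ => ?_
    have d1 : HasFDerivAt u (fderiv ℝ u (ρ • x)) (ρ • x) :=
      (hu.differentiable (by simp) _).hasFDerivAt
    have d2 := (d1.comp x ((hasFDerivAt_id (𝕜 := ℝ) x).const_smul ρ)).const_smul
      (ρ ^ ((N : ℝ) / 2))
    have := congrArg (fun L => L (EuclideanSpace.single i (1 : ℝ))) d2.fderiv
    have h : fderiv ℝ (dil ρ u) x (EuclideanSpace.single i 1) =
      (ρ ^ ((N : ℝ) / 2)) • (fderiv ℝ u (ρ • x) (ρ • (EuclideanSpace.single i 1))) := this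
    rw [h, map_smul, norm_smul, norm_smul, mul_pow, mul_pow, Real.norm_eq_abs, sq_abs,
      Real.norm_eq_abs, sq_abs, pow_half_sq N hρ, mul_assoc]
  have h2 : ∀ x, ‖dil ρ u x‖ ^ 2 / ‖x‖ ^ 2 =
      ρ ^ N * ρ ^ 2 * (‖u (ρ • x)‖ ^ 2 / ‖ρ • x‖ ^ 2) := by
    intro x
    rw [norm_dil hρ, mul_pow, pow_half_sq N hρ, norm_smul, Real.norm_of_nonneg hρ.le, mul_pow]
    rw [mul_assoc, mul_div_assoc]
    congr 1
    rw [← mul_div_assoc, mul_div_mul_left _ _ (by positivity)]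
  unfold kineticK
  simp only [h1, h2]
  rw [integral_const_mul, integral_const_mul, integral_dil hρ (gradNormSq u),
    integral_dil hρ (fun x => ‖u x‖ ^ 2 / ‖x‖ ^ 2)]
  field_simp

lemma hartree_dil {N : ℕ} {ρ : ℝ} (hρ : 0 < ρ) (α τ p : ℝ)
    (u : EuclideanSpace ℝ (Fin N) → ℂ) :
    hartreeP α τ p (dil ρ u) = ρ ^ (N * p - N - α + 2 * τ) * hartreeP α τ p u := by
  have hτ : ∀ x : EuclideanSpace ℝ (Fin N), ∀ b : ℝ, ‖x‖ ^ b = ρ ^ (-b) * ‖ρ • x‖ ^ b := by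
    intro x b
    rw [norm_smul, Real.norm_of_nonneg hρ.le, Real.mul_rpow hρ.le (norm_nonneg _), ← mul_assoc,
      ← Real.rpow_add hρ]
    simp
  have hp : ∀ x, ‖dil ρ u x‖ ^ p = ρ ^ (N * p / 2) * ‖u (ρ • x)‖ ^ p := by
    intro x
    rw [norm_dil hρ, Real.mul_rpow (by positivity) (norm_nonneg _), ← Real.rpow_mul hρ.le]
    congr 2; ring
  have hcv : ∀ x, rieszConvR α (fun y => ‖y‖ ^ (-τ) * ‖dil ρ u y‖ ^ p) x =
      ρ ^ (N * p / 2 + τ - α) * rieszConvR α (fun y => ‖y‖ ^ (-τ) * ‖u y‖ ^ p) (ρ • x) := by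
    intro x
    unfold rieszConvR
    have : ∀ y, rieszConst N α * ‖x - y‖ ^ (α - (N : ℝ)) * (‖y‖ ^ (-τ) * ‖dil ρ u y‖ ^ p) =
        (ρ ^ (-(α - (N : ℝ))) * ρ ^ (- -τ) * ρ ^ (N * p / 2)) *
        (fun z => rieszConst N α * ‖ρ • x - z‖ ^ (α - (N : ℝ)) * (‖z‖ ^ (-τ) * ‖u z‖ ^ p))
          (ρ • y) := by
      intro y
      rw [hτ (x - y), hτ y, hp, smul_sub]
      ring
    simp only [this]
    rw [integral_const_mul, integral_dil hρ (fun z => rieszConst N α * ‖ρ • x - z‖ ^ (α - (N : ℝ)) *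
      (‖z‖ ^ (-τ) * ‖u z‖ ^ p)), ← Real.rpow_natCast, ← Real.rpow_neg hρ.le,
      ← mul_assoc, ← Real.rpow_add hρ, ← Real.rpow_add hρ, ← Real.rpow_add hρ]
    congr 2; ring
  unfold hartreeP
  have : ∀ x, ‖x‖ ^ (-τ) * rieszConvR α (fun y => ‖y‖ ^ (-τ) * ‖dil ρ u y‖ ^ p) x *
      ‖dil ρ u x‖ ^ p = (ρ ^ (- -τ) * ρ ^ (N * p / 2 + τ - α) * ρ ^ (N * p / 2)) *
      (fun z => ‖z‖ ^ (-τ) * rieszConvR α (fun y => ‖y‖ ^ (-τ) * ‖u y‖ ^ p) z * ‖u z‖ ^ p)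
        (ρ • x) := by
    intro x
    rw [hτ x, hcv, hp]
    ring
  simp only [this]
  rw [integral_const_mul, integral_dil hρ (fun z => ‖z‖ ^ (-τ) * rieszConvR α
      (fun y => ‖y‖ ^ (-τ) * ‖u y‖ ^ p) z * ‖u z‖ ^ p), ← Real.rpow_natCast, ← Real.rpow_neg hρ.le,
      ← mul_assoc, ← Real.rpow_add hρ, ← Real.rpow_add hρ, ← Real.rpow_add hρ]
  congr 2; ring

/-- **Quantitative negativity of the virial functional below the mountain-pass level,
inverse-square potential Hartree case.** -/
theorem virial_negativity (N : ℕ) (hN : 3 ≤ N) (α τ lam p B : ℝ)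
    (hα : 0 < α) (hαN : α < N) (hlam : -(((N : ℝ) - 2) ^ 2 / 4) < lam)
    (hτ : 0 < τ) (hτN : τ < N) (hcnd : 0 < 2 - 2 * τ + α)
    (hp1 : 1 + α / N < p) (hp2 : p < 1 + (2 - 2 * τ + α) / ((N : ℝ) - 2))
    (hB : B = N * p - N - α + 2 * τ) (hB2 : 2 < B)
    (u : EuclideanSpace ℝ (Fin N) → ℂ)
    (hu : ContDiff ℝ (⊤ : ℕ∞) u) (hc : HasCompactSupport u) (hne : u ≠ 0)
    (hI : virialI α τ lam p B u < 0) :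
    virialI α τ lam p B u ≤ -(B / 2) * (mpLevel N α τ lam p B - actionS α τ lam p u) := by
  have hN0 : (0 : ℝ) < N := by exact_mod_cast (by omega : 0 < N)
  have hp0 : 0 < p := by
    have : 0 < α / N := by positivity
    linarith
  have hB0 : 0 < B := by linarith
  have hK : 0 < kineticK lam u := kineticK_pos hN hlam hu hc hne
  set K := kineticK lam u with hKdef
  set P := hartreeP α τ p u with hPdef
  set M := ∫ x, ‖u x‖ ^ 2 with hMdef
  set Q := B / (2 * p) * P with hQdef
  have hIu : virialI α τ lam p B u = K - Q := rfl
  have hSu : actionS α τ lam p u = K + M - (2 / B) * Q := by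
    have : actionS α τ lam p u = K + M - (1 / p) * P := rfl
    rw [this, hQdef]; field_simp
  rw [hIu] at hI
  have hQ : 0 < Q := by linarith
  set ρ : ℝ := (K / Q) ^ (1 / (B - 2)) with hρdef
  have hKQ : 0 < K / Q := by positivity
  have hρ : 0 < ρ := by positivity
  have hρ1 : ρ ≤ 1 := Real.rpow_le_one hKQ.le ((div_le_one hQ).2 (by linarith))
    (one_div_nonneg.2 (by linarith))
  have hρB : ρ ^ B * Q = ρ ^ 2 * K := by
    have h1 : ρ ^ (B - 2) = K / Q := by
      rw [hρdef, ← Real.rpow_mul hKQ.le, one_div_mul_cancel (by linarith), Real.rpow_one]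
    have h2 : ρ ^ B = ρ ^ (B - 2) * ρ ^ 2 := by
      rw [← Real.rpow_natCast, ← Real.rpow_add hρ]; congr 1; push_cast; ring
    rw [h2, h1]; field_simp
  have hkd : kineticK lam (dil ρ u) = ρ ^ 2 * K := kin_dil hρ lam hu
  have hpd : hartreeP α τ p (dil ρ u) = ρ ^ B * P := by rw [hartree_dil hρ, ← hB]
  have hId : virialI α τ lam p B (dil ρ u) = 0 := by
    unfold virialI
    rw [hkd, hpd, ← hρB, hQdef]; ring
  have hSd : actionS α τ lam p (dil ρ u) = ρ ^ 2 * K + M - (2 / B) * (ρ ^ 2 * K) := by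
    unfold actionS
    rw [hkd, hpd, mass_dil hρ, ← hMdef, ← hρB, hQdef]; field_simp
  have hdil : ContDiff ℝ (⊤ : ℕ∞) (dil ρ u) :=
    (hu.comp (contDiff_id.const_smul ρ)).const_smul _
  have hdilc : HasCompactSupport (dil ρ u) := by
    have : HasCompactSupport (fun x => u (ρ • x)) := hc.comp_smul hρ.ne'
    exact this.comp_left (g := fun z : ℂ => (ρ ^ ((N : ℝ) / 2)) • z) (by simp)
  have hdilne : dil ρ u ≠ 0 := by
    intro h
    apply hne
    funext x
    have := congrFun h (ρ⁻¹ • x)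
    have hpos : ρ ^ ((N : ℝ) / 2) ≠ 0 := by positivity
    simpa [dil, smul_smul, hρ.ne', hpos] using this
  have hm : mpLevel N α τ lam p B ≤ actionS α τ lam p (dil ρ u) := by
    apply csInf_le
    · refine ⟨0, ?_⟩
      rintro s ⟨v, hv, hvc, hvne, hvI, rfl⟩
      have hKv := kineticK_pos hN hlam hv hvc hvne
      have hMv : 0 ≤ ∫ x, ‖v x‖ ^ 2 := integral_nonneg fun x => by positivity
      unfold virialI at hvI
      unfold actionS
      have : (1 / p) * hartreeP α τ p v = (2 / B) * kineticK lam v := by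
        rw [sub_eq_zero.1 hvI]; field_simp
      rw [this]
      have h2B : 2 / B < 1 := (div_lt_one hB0).2 hB2
      nlinarith
    · exact ⟨dil ρ u, hdil, hdilc, hdilne, hId, rfl⟩
  have hfin : (B / 2) * (actionS α τ lam p (dil ρ u) - actionS α τ lam p u) ≤ Q - K := by
    rw [hSd, hSu]
    have e : (B / 2) * (ρ ^ 2 * K + M - (2 / B) * (ρ ^ 2 * K) - (K + M - (2 / B) * Q)) =
        Q - K + K * (B / 2 - 1) * (ρ ^ 2 - 1) := by field_simp; ring
    rw [e]
    have h1 : 0 ≤ K * (B / 2 - 1) := mul_nonneg hK.le (by linarith)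
    have h2 : ρ ^ 2 - 1 ≤ 0 := sub_nonpos.2 (pow_le_one₀ hρ.le hρ1)
    have h3 := mul_nonpos_of_nonneg_of_nonpos h1 h2
    linarith only [h3]
  have hmm := mul_le_mul_of_nonneg_left hm (by linarith : 0 ≤ B / 2)
  rw [hIu]
  linarith only [hmm, hfin]
end

section
/- (Exterior decay of the Hartree nonlinearity, inverse-square potential case.) Let N ≥ 3, 0 < α < N, λ ≥ 0, τ > 0 with min{τ, α, N−α, N−τ, 2−2τ+α} > 0 and τ < 1 + α/N, and let 1 + α/N < p < 1 + (2 − 2τ + α)/(N−2); set B := Np − N − α + 2τ. Then there exists a constant C > 0 such that for every R ≥ 1 and every smooth compactly supported u : ℝ^N → ℂ, ∫_{|x| > R} |x|^{−τ} (J_α ∗ (|·|^{−τ}|u|^p))(x) |u(x)|^p dx ≤ C R^{−τ} ‖u‖^{2p−B+τ} (‖√K_λ u‖²)^{(B−τ)/2}. -/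
open MeasureTheory

/-- The `L²` norm. -/
noncomputable def l2norm {N : ℕ} (u : EuclideanSpace ℝ (Fin N) → ℂ) : ℝ :=
  (∫ x, ‖u x‖ ^ 2) ^ ((1 : ℝ) / 2)

open scoped ENNReal

noncomputable def kf {N : ℕ} (P : Set ℝ) (ρ σ : ℝ) (x : EuclideanSpace ℝ (Fin N)) : ℝ≥0∞ :=
  open Classical in if ‖x‖ / ρ ∈ P then ENNReal.ofReal (‖x‖ ^ (-σ)) else 0

lemma kf_pow {N : ℕ} (P : Set ℝ) (ρ σ T : ℝ) (hT : 0 < T) (x : EuclideanSpace ℝ (Fin N)) :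
    kf P ρ σ x = kf P ρ (σ / T) x ^ T := by
  unfold kf
  split_ifs
  · rw [ENNReal.ofReal_rpow_of_nonneg (by positivity) hT.le, ← Real.rpow_mul (norm_nonneg _)]
    congr 2; field_simp
  · simp [hT]

lemma kf_measurable {N : ℕ} (P : Set ℝ) (hP : MeasurableSet P) (ρ σ : ℝ) :
    Measurable (kf P ρ σ : EuclideanSpace ℝ (Fin N) → ℝ≥0∞) := by
  unfold kf
  refine Measurable.ite ?_ (by fun_prop) measurable_const
  exact (measurable_norm.div_const ρ) hP

lemma kf_scale {N : ℕ} (P : Set ℝ) (hP : MeasurableSet P) (ρ σ : ℝ) (hρ : 0 < ρ) :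
    ∫⁻ x : EuclideanSpace ℝ (Fin N), kf P ρ σ x =
      ENNReal.ofReal (ρ ^ ((N : ℝ) - σ)) * ∫⁻ x : EuclideanSpace ℝ (Fin N), kf P 1 σ x := by
  have h1 : ∀ x : EuclideanSpace ℝ (Fin N), kf P ρ σ x =
      ENNReal.ofReal (ρ ^ (-σ)) * kf P 1 σ (ρ⁻¹ • x) := by
    intro x
    unfold kf
    have : ‖ρ⁻¹ • x‖ = ‖x‖ / ρ := by
      rw [norm_smul, Real.norm_of_nonneg (by positivity)]; ring
    rw [this, div_one]
    split_ifs
    · rw [← ENNReal.ofReal_mul (by positivity), ← Real.mul_rpow hρ.le (by positivity)]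
      congr 2; field_simp
    · simp
  simp_rw [h1]
  have hm : Measurable (fun x : EuclideanSpace ℝ (Fin N) => kf P 1 σ (ρ⁻¹ • x)) :=
    (kf_measurable P hP 1 σ).comp (measurable_const_smul _)
  rw [lintegral_const_mul _ hm]
  have h2 : ∫⁻ x : EuclideanSpace ℝ (Fin N), kf P 1 σ (ρ⁻¹ • x) =
      ∫⁻ x : EuclideanSpace ℝ (Fin N), kf P 1 σ x ∂(Measure.map (ρ⁻¹ • ·) volume) := by
    rw [lintegral_map (kf_measurable P hP 1 σ) (measurable_const_smul _)]
  rw [h2, Measure.map_addHaar_smul _ (by positivity), lintegral_smul_measure, smul_eq_mul, ← mul_assoc,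
    ← ENNReal.ofReal_mul (by positivity)]
  congr 2
  rw [sub_eq_add_neg, Real.rpow_add hρ, mul_comm, finrank_euclideanSpace_fin, Real.rpow_natCast]
  congr 1
  rw [inv_pow, inv_inv, abs_of_pos (by positivity)]

lemma kf_fin_aux {N : ℕ} (hN : 0 < N) (P : Set ℝ) (hP : MeasurableSet P) (σ : ℝ)
    (h : IntegrableOn (fun y : ℝ => y ^ ((N : ℝ) - 1 - σ)) (P ∩ Set.Ioi 0)) :
    ∫⁻ x : EuclideanSpace ℝ (Fin N), kf P 1 σ x ≠ ⊤ := by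
  have : Nonempty (Fin N) := ⟨⟨0, hN⟩⟩
  have hh := (integrable_fun_norm_addHaar (volume : Measure (EuclideanSpace ℝ (Fin N)))
    (f := P.indicator (fun y : ℝ => y ^ (-σ)))).2 (by
      rw [finrank_euclideanSpace_fin]
      have := (integrable_indicator_iff (hP.inter measurableSet_Ioi)).2 h
      have h3 := this.integrableOn (s := Set.Ioi 0)
      refine h3.congr_fun ?_ measurableSet_Ioi
      intro y hy
      by_cases hyP : y ∈ P
      · simp only [Set.indicator, Set.mem_inter_iff, hyP, hy, and_self, if_true, smul_eq_mul]
        rw [sub_eq_add_neg, Real.rpow_add hy, ← Real.rpow_natCast, Nat.cast_sub hN, Nat.cast_one]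
      · simp [Set.indicator, hyP])
  have := hh.hasFiniteIntegral
  unfold HasFiniteIntegral at this
  refine (lt_of_le_of_lt (lintegral_mono fun x => ?_) this).ne
  unfold kf
  rw [div_one]
  by_cases hx : ‖x‖ ∈ P
  · simp only [hx, if_true, Set.indicator_of_mem]
    rw [Real.enorm_of_nonneg (by positivity)]
  · simp [hx]

lemma kf_fin_near {N : ℕ} (hN : 0 < N) (σ : ℝ) (h : σ < N) :
    ∫⁻ x : EuclideanSpace ℝ (Fin N), kf (Set.Iio 1) 1 σ x ≠ ⊤ := by
  apply kf_fin_aux hN _ measurableSet_Iio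
  rw [Set.Iio_inter_Ioi, intervalIntegral.integrableOn_Ioo_rpow_iff one_pos]
  linarith

lemma kf_fin_far {N : ℕ} (hN : 0 < N) (σ : ℝ) (h : N < σ) :
    ∫⁻ x : EuclideanSpace ℝ (Fin N), kf (Set.Ici 1) 1 σ x ≠ ⊤ := by
  apply kf_fin_aux hN _ measurableSet_Ici
  have : Set.Ici (1:ℝ) ∩ Set.Ioi 0 = Set.Ici 1 := by
    ext y; simp; intro h; linarith
  rw [this, integrableOn_Ici_iff_integrableOn_Ioi, integrableOn_Ioi_rpow_iff one_pos]
  linarith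

/-- Young's inequality, trilinear form. -/
lemma young3 {N : ℕ} (f k h : EuclideanSpace ℝ (Fin N) → ℝ≥0∞) (hf : Measurable f)
    (hk : Measurable k) (hh : Measurable h)
    (X T H : ℝ) (hX : X ≤ 1) (hT : T ≤ 1) (hH : H ≤ 1) 
    (hsum : X + T + H = 2) :
    ∫⁻ x, ∫⁻ y, f x ^ X * k (x - y) ^ T * h y ^ H ≤
      (∫⁻ x, f x) ^ X * (∫⁻ x, k x) ^ T * (∫⁻ x, h x) ^ H := by
  have split : ∀ a b c : ℝ≥0∞, a ^ X * b ^ T * c ^ H =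
      (a * b) ^ (1 - H) * (a * c) ^ (1 - T) * (b * c) ^ (1 - X) := by
    intro a b c
    have e1 : X = (1 - H) + (1 - T) := by linarith
    have e2 : T = (1 - H) + (1 - X) := by linarith
    have e3 : H = (1 - T) + (1 - X) := by linarith
    rw [ENNReal.mul_rpow_of_nonneg _ _ (by linarith), ENNReal.mul_rpow_of_nonneg _ _ (by linarith),
      ENNReal.mul_rpow_of_nonneg _ _ (by linarith)]
    have f1 : a ^ X = a ^ (1 - H) * a ^ (1 - T) := by
      rw [← ENNReal.rpow_add_of_nonneg _ _ (by linarith) (by linarith), ← e1]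
    have f2 : b ^ T = b ^ (1 - H) * b ^ (1 - X) := by
      rw [← ENNReal.rpow_add_of_nonneg _ _ (by linarith) (by linarith), ← e2]
    have f3 : c ^ H = c ^ (1 - T) * c ^ (1 - X) := by
      rw [← ENNReal.rpow_add_of_nonneg _ _ (by linarith) (by linarith), ← e3]
    rw [f1, f2, f3]; ring
  let F : Fin 3 → EuclideanSpace ℝ (Fin N) × EuclideanSpace ℝ (Fin N) → ℝ≥0∞ := ![fun z => f z.1 * k (z.1 - z.2), fun z => f z.1 * h z.2,
    fun z => k (z.1 - z.2) * h z.2]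
  have m0 : Measurable (fun z : EuclideanSpace ℝ (Fin N) × EuclideanSpace ℝ (Fin N) => f z.1 * k (z.1 - z.2)) := by fun_prop
  have m1 : Measurable (fun z : EuclideanSpace ℝ (Fin N) × EuclideanSpace ℝ (Fin N) => f z.1 * h z.2) := by fun_prop
  have m2 : Measurable (fun z : EuclideanSpace ℝ (Fin N) × EuclideanSpace ℝ (Fin N) => k (z.1 - z.2) * h z.2) := by fun_prop
  have key := ENNReal.lintegral_prod_norm_pow_le (μ := (volume : Measure (EuclideanSpace ℝ (Fin N))).prod volume)
    Finset.univ (f := F) (p := ![1 - H, 1 - T, 1 - X])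
    (by intro i _; fin_cases i; exacts [m0.aemeasurable, m1.aemeasurable, m2.aemeasurable])
    (by simp [Fin.sum_univ_three]; linarith)
    (by intro i _; fin_cases i <;> simp <;> assumption)
  simp only [Fin.prod_univ_three, F, Matrix.cons_val_zero, Matrix.cons_val_one, Matrix.cons_val]
    at key
  have I0 : ∫⁻ z : EuclideanSpace ℝ (Fin N) × EuclideanSpace ℝ (Fin N), f z.1 * k (z.1 - z.2) ∂(volume.prod volume) =
      (∫⁻ x, f x) * ∫⁻ x, k x := by
    rw [lintegral_prod _ m0.aemeasurable]
    have : ∀ x : EuclideanSpace ℝ (Fin N), ∫⁻ y, f x * k (x - y) = f x * ∫⁻ y, k y := by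
      intro x
      rw [lintegral_const_mul _ (by fun_prop), lintegral_sub_left_eq_self k x]
    simp only [this]
    rw [lintegral_mul_const _ hf]
  have I1 : ∫⁻ z : EuclideanSpace ℝ (Fin N) × EuclideanSpace ℝ (Fin N), f z.1 * h z.2 ∂(volume.prod volume) =
      (∫⁻ x, f x) * ∫⁻ x, h x := by
    rw [lintegral_prod _ m1.aemeasurable]
    simp only [lintegral_const_mul _ hh]
    rw [lintegral_mul_const _ hf]
  have I2 : ∫⁻ z : EuclideanSpace ℝ (Fin N) × EuclideanSpace ℝ (Fin N), k (z.1 - z.2) * h z.2 ∂(volume.prod volume) =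
      (∫⁻ x, k x) * ∫⁻ x, h x := by
    rw [lintegral_prod_symm _ m2.aemeasurable]
    have : ∀ y : EuclideanSpace ℝ (Fin N), ∫⁻ x, k (x - y) * h y = (∫⁻ x, k x) * h y := by
      intro y
      rw [lintegral_mul_const _ (by fun_prop), lintegral_sub_right_eq_self k y]
    simp only [this]
    rw [lintegral_const_mul _ hh]
  rw [I0, I1, I2, ← split] at key
  refine le_trans (le_of_eq ?_) key
  rw [lintegral_prod]
  · simp only [split]
  · fun_prop

/-- Quadrilinear form -/
lemma young4 {N : ℕ} (f k w g : EuclideanSpace ℝ (Fin N) → ℝ≥0∞) (hf : Measurable f)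
    (hk : Measurable k) (hw : Measurable w) (hg : Measurable g)
    (X T S Y : ℝ) (hX : X ≤ 1) (hT : T ≤ 1) (hS : 0 < S) (hY : 0 < Y) (hH : S + Y ≤ 1) 
    (hsum : X + T + S + Y = 2) :
    ∫⁻ x, ∫⁻ y, f x ^ X * k (x - y) ^ T * (w y ^ S * g y ^ Y) ≤
      (∫⁻ x, f x) ^ X * (∫⁻ x, k x) ^ T * ((∫⁻ x, w x) ^ S * (∫⁻ x, g x) ^ Y) := by
  have hH0 : 0 < S + Y := by positivity
  have e : ∀ a b : ℝ≥0∞, a ^ S * b ^ Y = (a ^ (S / (S + Y)) * b ^ (Y / (S + Y))) ^ (S + Y) := by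
    intro a b
    rw [ENNReal.mul_rpow_of_nonneg _ _ hH0.le, ← ENNReal.rpow_mul, ← ENNReal.rpow_mul,
      div_mul_cancel₀ _ hH0.ne', div_mul_cancel₀ _ hH0.ne']
  have hol : ∫⁻ x, w x ^ (S / (S + Y)) * g x ^ (Y / (S + Y)) ≤
      (∫⁻ x, w x) ^ (S / (S + Y)) * (∫⁻ x, g x) ^ (Y / (S + Y)) :=
    ENNReal.lintegral_mul_norm_pow_le hw.aemeasurable hg.aemeasurable (by positivity)
      (by positivity) (by field_simp)
  simp only [e]
  refine (young3 f k _ hf hk (by fun_prop) X T (S + Y) hX hT hH (by linarith)).trans ?_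
  gcongr
lemma exists_params (a t n p : ℝ) (ha : 0 < a) (ha1 : a < 1) (ht : 0 < t)
    (hn1 : n < 1) (hp1 : 1 + a < p) (hp2 : p * n < 1 + a - 2 * t) :
    ∃ X ε : ℝ, 0 < ε ∧ ε < 1 - a ∧ ε < a ∧ ε < t ∧ X ≤ 1 ∧ p * n / 2 ≤ X ∧ X ≤ p / 2 ∧ a + ε ≤ X ∧
      p * n / 2 ≤ 1 + a - t - X - 2 * ε ∧ 1 + a - t - X + 2 * ε ≤ p / 2 := by
  have hpn : p * n < p := by nlinarith
  obtain ⟨X, hX1, hX2⟩ : ∃ X, max a (max (p * n / 2) (1 + a - t - p / 2)) < X ∧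
      X < min 1 (min (p / 2) (1 + a - t - p * n / 2)) := by
    apply exists_between
    simp only [max_lt_iff, lt_min_iff]
    refine ⟨⟨?_, ?_, ?_⟩, ⟨?_, ?_, ?_⟩, ⟨?_, ?_, ?_⟩⟩ <;> linarith
  simp only [max_lt_iff, lt_min_iff] at hX1 hX2
  obtain ⟨h1, h2, h3⟩ := hX1
  obtain ⟨h4, h5, h6⟩ := hX2
  obtain ⟨ε, he, he'⟩ : ∃ ε, 0 < ε ∧ ε < min (min (1 - a) a) (min t (min (X - a)
      (min ((1 + a - t - X - p * n / 2) / 2) ((p / 2 - (1 + a - t - X)) / 2)))) := by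
    apply exists_between
    simp only [lt_min_iff]
    refine ⟨⟨?_, ?_⟩, ?_, ?_, ?_, ?_⟩ <;> linarith
  simp only [lt_min_iff] at he'
  obtain ⟨⟨g1, g2⟩, g3, g4, g5, g6⟩ := he'
  refine ⟨X, ε, he, g1, g2, g3, ?_, ?_, ?_, ?_, ?_, ?_⟩ <;> linarith

noncomputable def aA {N : ℕ} (u : EuclideanSpace ℝ (Fin N) → ℂ) : ℝ≥0∞ :=
  (∫⁻ x, ‖u x‖ₑ ^ (2:ℝ)) ^ ((1:ℝ)/2)

noncomputable def gG {N : ℕ} (u : EuclideanSpace ℝ (Fin N) → ℂ) : ℝ≥0∞ :=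
  (∫⁻ x, ENNReal.ofReal (gradNormSq u x)) ^ ((1:ℝ)/2)

lemma gradNormSq_nonneg {N : ℕ} (u : EuclideanSpace ℝ (Fin N) → ℂ) (x) : 0 ≤ gradNormSq u x :=
  Finset.sum_nonneg fun _ _ => by positivity

lemma fderiv_le_grad {N : ℕ} (u : EuclideanSpace ℝ (Fin N) → ℂ) (x : EuclideanSpace ℝ (Fin N)) :
    ‖fderiv ℝ u x‖ ≤ Real.sqrt (gradNormSq u x) := by
  apply ContinuousLinearMap.opNorm_le_bound _ (Real.sqrt_nonneg _)
  intro v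
  have hv : v = ∑ i, v i • EuclideanSpace.single i (1:ℝ) := by
    ext j
    simp [Finset.sum_apply, Pi.single_apply]
  calc ‖fderiv ℝ u x v‖ = ‖∑ i, v i • fderiv ℝ u x (EuclideanSpace.single i (1:ℝ))‖ := by
        conv_lhs => rw [hv]
        rw [map_sum]; simp only [map_smul]
    _ ≤ ∑ i, ‖v i • fderiv ℝ u x (EuclideanSpace.single i (1:ℝ))‖ := norm_sum_le _ _
    _ = ∑ i, ‖fderiv ℝ u x (EuclideanSpace.single i (1:ℝ))‖ * ‖v i‖ := by
        simp only [norm_smul, mul_comm]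
    _ ≤ Real.sqrt (∑ i, ‖fderiv ℝ u x (EuclideanSpace.single i (1:ℝ))‖ ^ 2) *
        Real.sqrt (∑ i, ‖v i‖ ^ 2) := Real.sum_mul_le_sqrt_mul_sqrt _ _ _
    _ = _ := by rw [← EuclideanSpace.norm_eq]; rfl

lemma sobolev {N : ℕ} (hN : 3 ≤ N) : ∃ C : ℝ≥0∞, C ≠ ⊤ ∧ ∀ u : EuclideanSpace ℝ (Fin N) → ℂ,
    ContDiff ℝ (⊤ : ℕ∞) u → HasCompactSupport u →
    (∫⁻ x, ‖u x‖ₑ ^ (2 * (N:ℝ) / (N - 2))) ^ (((N:ℝ) - 2) / (2 * N)) ≤ C * gG u := by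
  have hN' : (3:ℝ) ≤ N := by exact_mod_cast hN
  have hN2 : (0:ℝ) < N - 2 := by linarith
  have hN0 : (0:ℝ) < N := by linarith
  refine ⟨SNormLESNormFDerivOfEqConst ℂ (volume : Measure (EuclideanSpace ℝ (Fin N))) ((2:NNReal):ℝ),
    ENNReal.coe_ne_top, fun u hu hc => ?_⟩
  have hq : 0 < 2 * (N:ℝ) / (N - 2) := by positivity
  let q : NNReal := ⟨2 * (N:ℝ) / (N - 2), hq.le⟩
  have hqv : (q:ℝ) = 2 * (N:ℝ) / (N - 2) := rfl
  have key := eLpNorm_le_eLpNorm_fderiv_of_eq (μ := (volume : Measure (EuclideanSpace ℝ (Fin N))))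
    (F := ℂ) (u := u) (p := 2) (p' := q) (hu.of_le (by exact_mod_cast le_top)) hc (by norm_num)
    (by rw [finrank_euclideanSpace_fin]; omega)
    (by rw [finrank_euclideanSpace_fin]; rw [hqv]; push_cast; field_simp)
  have hq0 : (q : ℝ≥0∞) ≠ 0 := by
    simp only [ne_eq, ENNReal.coe_eq_zero]
    intro h
    have := congrArg NNReal.toReal h
    rw [hqv, NNReal.coe_zero] at this
    linarith
  rw [eLpNorm_eq_lintegral_rpow_enorm_toReal hq0 ENNReal.coe_ne_top,
    eLpNorm_eq_lintegral_rpow_enorm_toReal (by simp) (by simp)] at key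
  have e1 : ((q:ℝ≥0∞)).toReal = 2 * (N:ℝ) / (N - 2) := rfl
  rw [e1] at key
  have e2 : 1 / (2 * (N:ℝ) / (N - 2)) = ((N:ℝ) - 2) / (2 * N) := by field_simp
  rw [e2] at key
  refine key.trans ?_
  have e3 : (((2:NNReal):ℝ≥0∞)).toReal = 2 := by simp
  rw [e3]
  unfold gG
  gcongr with x
  rw [← ofReal_norm, ENNReal.ofReal_rpow_of_nonneg (norm_nonneg _) (by norm_num)]
  apply ENNReal.ofReal_le_ofReal
  rw [Real.rpow_two]
  calc ‖fderiv ℝ u x‖ ^ 2 ≤ Real.sqrt (gradNormSq u x) ^ 2 := by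
        gcongr; exact fderiv_le_grad u x
    _ = _ := Real.sq_sqrt (gradNormSq_nonneg u x)

lemma gn {N : ℕ} (hN : 3 ≤ N) (p X : ℝ) (hX0 : 0 < X)
    (hX1 : p * (((N:ℝ) - 2) / N) / 2 ≤ X) (hX2 : X ≤ p / 2) :
    ∃ C : ℝ≥0∞, C ≠ ⊤ ∧ ∀ u : EuclideanSpace ℝ (Fin N) → ℂ,
    ContDiff ℝ (⊤ : ℕ∞) u → HasCompactSupport u →
    (∫⁻ x, ‖u x‖ₑ ^ (p / X)) ^ X ≤
      C * (aA u ^ (p - N * (p / 2 - X)) * gG u ^ (N * (p / 2 - X))) := by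
  have hN' : (3:ℝ) ≤ N := by exact_mod_cast hN
  have hN2 : (0:ℝ) < N - 2 := by linarith
  have hN0 : (0:ℝ) < N := by linarith
  obtain ⟨C, hC, hS⟩ := sobolev hN
  have hθ : 0 ≤ N * (p / 2 - X) := by apply mul_nonneg hN0.le; linarith
  have hθ' : 0 ≤ p - N * (p / 2 - X) := by
    have : p * (((N:ℝ) - 2) / N) / 2 * N ≤ X * N := by gcongr
    have e : p * (((N:ℝ) - 2) / N) / 2 * N = p * (N - 2) / 2 := by field_simp
    nlinarith
  refine ⟨C ^ (N * (p / 2 - X)), ENNReal.rpow_ne_top_of_nonneg hθ hC, fun u hu hc => ?_⟩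
  set s : ℝ := 2 * (N:ℝ) / (N - 2) with hs
  have hs0 : 0 < s := by positivity
  -- interpolation weights
  set m1 : ℝ := (p - N * (p / 2 - X)) / (2 * X) with hm1
  set m2 : ℝ := N * (p / 2 - X) / (s * X) with hm2
  have hm : m1 + m2 = 1 := by
    rw [hm1, hm2, hs]; field_simp; ring
  have hexp : 2 * m1 + s * m2 = p / X := by
    rw [hm1, hm2]; field_simp; ring
  have hm10 : 0 ≤ m1 := by positivity
  have hm20 : 0 ≤ m2 := by positivity
  have hcm : Measurable u := hu.continuous.measurable
  have hol := ENNReal.lintegral_mul_norm_pow_le (μ := volume) (f := fun x => ‖u x‖ₑ ^ (2:ℝ))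
    (g := fun x => ‖u x‖ₑ ^ s) (by fun_prop) (by fun_prop) hm10 hm20 hm
  have e : ∀ x, (‖u x‖ₑ ^ (2:ℝ)) ^ m1 * (‖u x‖ₑ ^ s) ^ m2 = ‖u x‖ₑ ^ (p / X) := by
    intro x
    rw [← ENNReal.rpow_mul, ← ENNReal.rpow_mul,
      ← ENNReal.rpow_add_of_nonneg _ _ (by positivity) (by positivity), hexp]
  simp only [e] at hol
  have h2 := hS u hu hc
  have e1 : ((∫⁻ x, ‖u x‖ₑ ^ (2:ℝ)) ^ m1) ^ X = aA u ^ (p - N * (p / 2 - X)) := by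
    unfold aA
    rw [← ENNReal.rpow_mul, ← ENNReal.rpow_mul]
    congr 1; rw [hm1]; field_simp
  have e2 : ((∫⁻ x, ‖u x‖ₑ ^ s) ^ m2) ^ X =
      ((∫⁻ x, ‖u x‖ₑ ^ s) ^ (((N:ℝ) - 2) / (2 * N))) ^ (N * (p / 2 - X)) := by
    rw [← ENNReal.rpow_mul, ← ENNReal.rpow_mul]
    congr 1; rw [hm2, hs]; field_simp
  calc (∫⁻ x, ‖u x‖ₑ ^ (p / X)) ^ X
      ≤ ((∫⁻ x, ‖u x‖ₑ ^ (2:ℝ)) ^ m1 * (∫⁻ x, ‖u x‖ₑ ^ s) ^ m2) ^ X := by gcongr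
    _ = aA u ^ (p - N * (p / 2 - X)) *
        ((∫⁻ x, ‖u x‖ₑ ^ s) ^ (((N:ℝ) - 2) / (2 * N))) ^ (N * (p / 2 - X)) := by
        rw [ENNReal.mul_rpow_of_nonneg _ _ hX0.le, e1, e2]
    _ ≤ aA u ^ (p - N * (p / 2 - X)) * (C * gG u) ^ (N * (p / 2 - X)) := by gcongr
    _ = _ := by rw [ENNReal.mul_rpow_of_nonneg _ _ hθ]; ring
lemma term_bound {N : ℕ} (hN : 3 ≤ N) (α τ p X T S Y : ℝ) (P1 P2 : Set ℝ)
    (hP1 : MeasurableSet P1) (hP2 : MeasurableSet P2)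
    (hX0 : 0 < X) (hX : X ≤ 1) (hT0 : 0 < T) (hT : T ≤ 1) (hS : 0 < S) (hY : 0 < Y)
    (hH : S + Y ≤ 1) (hsum : X + T + S + Y = 2)
    (hX1 : p * (((N:ℝ) - 2) / N) / 2 ≤ X) (hX2 : X ≤ p / 2)
    (hY1 : p * (((N:ℝ) - 2) / N) / 2 ≤ Y) (hY2 : Y ≤ p / 2)
    (hf1 : ∫⁻ x : EuclideanSpace ℝ (Fin N), kf P1 1 ((N - α) / T) x ≠ ⊤)
    (hf2 : ∫⁻ x : EuclideanSpace ℝ (Fin N), kf P2 1 (τ / S) x ≠ ⊤) :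
    ∃ C : ℝ≥0∞, C ≠ ⊤ ∧ ∀ u : EuclideanSpace ℝ (Fin N) → ℂ,
    ContDiff ℝ (⊤ : ℕ∞) u → HasCompactSupport u → ∀ A G : ℝ, 0 < A → 0 < G →
      aA u = ENNReal.ofReal A → gG u = ENNReal.ofReal G →
      ∫⁻ x, ∫⁻ y, ‖u x‖ₑ ^ p * kf P1 (A / G) (N - α) (x - y) * (kf P2 (A / G) τ y * ‖u y‖ₑ ^ p) ≤
      C * ENNReal.ofReal (A ^ (2 * p - (N * p - N - α + τ)) * G ^ (N * p - N - α + τ)) := by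
  obtain ⟨C1, hC1, h1⟩ := gn hN p X hX0 hX1 hX2
  obtain ⟨C2, hC2, h2⟩ := gn hN p Y hY hY1 hY2
  have hN0 : (0:ℝ) < N := by have : (3:ℝ) ≤ N := by exact_mod_cast hN
                             linarith
  set K1 := ∫⁻ x : EuclideanSpace ℝ (Fin N), kf P1 1 ((N - α) / T) x with hK1
  set K2 := ∫⁻ x : EuclideanSpace ℝ (Fin N), kf P2 1 (τ / S) x with hK2
  refine ⟨C1 * K1 ^ T * (K2 ^ S * C2), ENNReal.mul_ne_top (ENNReal.mul_ne_top hC1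
    (ENNReal.rpow_ne_top_of_nonneg hT0.le hf1)) (ENNReal.mul_ne_top
    (ENNReal.rpow_ne_top_of_nonneg hS.le hf2) hC2), fun u hu hc A G hA hG hAu hGu => ?_⟩
  have hum : Measurable u := hu.continuous.measurable
  set ρ := A / G with hρ
  have hρ0 : 0 < ρ := by positivity
  have ex : ∀ Z : ℝ, 0 < Z → ∀ x, ‖u x‖ₑ ^ p = (‖u x‖ₑ ^ (p / Z)) ^ Z := by
    intro Z hZ x
    rw [← ENNReal.rpow_mul, div_mul_cancel₀ _ hZ.ne']
  have hy := young4 (fun x => ‖u x‖ₑ ^ (p / X)) (kf P1 ρ ((N - α) / T)) (kf P2 ρ (τ / S))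
    (fun x => ‖u x‖ₑ ^ (p / Y)) (by fun_prop) (kf_measurable _ hP1 _ _) (kf_measurable _ hP2 _ _)
    (by fun_prop) X T S Y hX hT hS hY hH hsum
  simp only [← ex X hX0, ← ex Y hY, ← kf_pow _ _ _ T hT0, ← kf_pow _ _ _ S hS] at hy
  refine hy.trans ?_
  rw [kf_scale P1 hP1 _ _ hρ0, kf_scale P2 hP2 _ _ hρ0, ← hK1, ← hK2,
    ENNReal.mul_rpow_of_nonneg _ _ hT0.le, ENNReal.mul_rpow_of_nonneg _ _ hS.le,
    ENNReal.ofReal_rpow_of_nonneg (by positivity) hT0.le,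
    ENNReal.ofReal_rpow_of_nonneg (by positivity) hS.le]
  have g1 := h1 u hu hc
  have g2 := h2 u hu hc
  rw [hAu, hGu, ENNReal.ofReal_rpow_of_pos hA, ENNReal.ofReal_rpow_of_pos hG,
    ← ENNReal.ofReal_mul (by positivity)] at g1 g2
  have hreal : A ^ (2 * p - (N * p - N - α + τ)) * G ^ (N * p - N - α + τ) =
      (A ^ (p - N * (p / 2 - X)) * G ^ (N * (p / 2 - X))) * ((ρ ^ (N - (N - α) / T)) ^ T) *
      (((ρ ^ (N - τ / S)) ^ S) * (A ^ (p - N * (p / 2 - Y)) * G ^ (N * (p / 2 - Y)))) := by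
    rw [← Real.rpow_mul hρ0.le, ← Real.rpow_mul hρ0.le]
    have t1 : (N - (N - α) / T) * T = N * T - (N - α) := by field_simp
    have t2 : (N - τ / S) * S = N * S - τ := by field_simp
    rw [t1, t2]
    simp only [Real.rpow_def_of_pos hA, Real.rpow_def_of_pos hG, Real.rpow_def_of_pos hρ0,
      ← Real.exp_add]
    congr 1
    rw [hρ, Real.log_div hA.ne' hG.ne']
    have : S = 2 - X - T - Y := by linarith
    rw [this]; ring
  rw [hreal, ENNReal.ofReal_mul (by positivity), ENNReal.ofReal_mul (by positivity),
    ENNReal.ofReal_mul (p := (ρ ^ (N - τ / S)) ^ S) (by positivity)]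
  set a1 := ENNReal.ofReal (A ^ (p - N * (p / 2 - X)) * G ^ (N * (p / 2 - X)))
  set a2 := ENNReal.ofReal (A ^ (p - N * (p / 2 - Y)) * G ^ (N * (p / 2 - Y)))
  set b1 := ENNReal.ofReal ((ρ ^ (N - (N - α) / T)) ^ T)
  set b2 := ENNReal.ofReal ((ρ ^ (N - τ / S)) ^ S)
  calc _ ≤ C1 * a1 * (b1 * K1 ^ T) * (b2 * K2 ^ S * (C2 * a2)) := by gcongr
    _ = _ := by ring

lemma kf_add {N : ℕ} (ρ σ : ℝ) (x : EuclideanSpace ℝ (Fin N)) :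
    ENNReal.ofReal (‖x‖ ^ (-σ)) = kf (Set.Iio 1) ρ σ x + kf (Set.Ici 1) ρ σ x := by
  unfold kf
  by_cases h : ‖x‖ / ρ < 1
  · simp [h, not_le.2 h]
  · simp [h, not_lt.1 h]

lemma hartree_bound {N : ℕ} (hN : 3 ≤ N) (α τ p : ℝ)
    (hα : 0 < α) (hαN : α < N) (hτ : 0 < τ)
    (hp1 : 1 + α / N < p) (hp2 : p < 1 + (2 - 2 * τ + α) / ((N : ℝ) - 2)) :
    ∃ C : ℝ≥0∞, C ≠ ⊤ ∧ ∀ u : EuclideanSpace ℝ (Fin N) → ℂ,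
    ContDiff ℝ (⊤ : ℕ∞) u → HasCompactSupport u → ∀ A G : ℝ, 0 < A → 0 < G →
      aA u = ENNReal.ofReal A → gG u = ENNReal.ofReal G →
      ∫⁻ x, ∫⁻ y, ‖u x‖ₑ ^ p * ENNReal.ofReal (‖x - y‖ ^ (α - N)) *
        (ENNReal.ofReal (‖y‖ ^ (-τ)) * ‖u y‖ₑ ^ p) ≤
      C * ENNReal.ofReal (A ^ (2 * p - (N * p - N - α + τ)) * G ^ (N * p - N - α + τ)) := by
  have hN' : (3:ℝ) ≤ N := by exact_mod_cast hN
  have hN2 : (0:ℝ) < N - 2 := by linarith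
  have hN0 : (0:ℝ) < N := by linarith
  have hNn : 0 < N := by omega
  have hp0 : 0 < p := by have : 0 < α / N := by positivity
                         linarith
  obtain ⟨X, ε, he, e1, e2, e3, x1, x2, x3, x4, y1, y2⟩ :=
    exists_params (α / N) (τ / N) (((N:ℝ) - 2) / N) p (by positivity)
      ((div_lt_one hN0).2 hαN) (by positivity) ((div_lt_one hN0).2 (by linarith)) hp1 (by
        have h := mul_lt_mul_of_pos_right hp2 hN2
        rw [add_mul, div_mul_cancel₀ _ hN2.ne'] at h
        rw [← mul_div_assoc, div_lt_iff₀ hN0]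
        have : (1 + α / N - 2 * (τ / N)) * N = N + α - 2 * τ := by field_simp
        rw [this]; linarith)
  have hpn : 0 < p * (((N:ℝ) - 2) / N) / 2 := by positivity
  -- near and far finiteness
  have near : ∀ σ T : ℝ, 0 < T → σ / N < T →
      ∫⁻ x : EuclideanSpace ℝ (Fin N), kf (Set.Iio 1) 1 (σ / T) x ≠ ⊤ := by
    intro σ T hT h
    apply kf_fin_near hNn
    rw [div_lt_iff₀ hT]; rw [div_lt_iff₀ hN0] at h; linarith
  have far : ∀ σ T : ℝ, 0 < T → T < σ / N →
      ∫⁻ x : EuclideanSpace ℝ (Fin N), kf (Set.Ici 1) 1 (σ / T) x ≠ ⊤ := by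
    intro σ T hT h
    apply kf_fin_far hNn
    rw [lt_div_iff₀ hT]; rw [lt_div_iff₀ hN0] at h; linarith
  have hd : ((N:ℝ) - α) / N = 1 - α / N := by field_simp
  obtain ⟨C1, hC1, h1⟩ := term_bound hN α τ p X (1 - α / N + ε) (τ / N + ε)
    (1 + α / N - τ / N - X - 2 * ε) (Set.Iio 1) (Set.Iio 1) measurableSet_Iio measurableSet_Iio
    (by linarith) x1 (by linarith) (by linarith) (by linarith) (by linarith) (by linarith)
    (by ring) x2 x3 y1 (by linarith) (near _ _ (by linarith) (by linarith))
    (near _ _ (by linarith) (by linarith))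
  obtain ⟨C2, hC2, h2⟩ := term_bound hN α τ p X (1 - α / N + ε) (τ / N - ε)
    (1 + α / N - τ / N - X) (Set.Iio 1) (Set.Ici 1) measurableSet_Iio measurableSet_Ici
    (by linarith) x1 (by linarith) (by linarith) (by linarith) (by linarith) (by linarith)
    (by ring) x2 x3 (by linarith) (by linarith) (near _ _ (by linarith) (by linarith))
    (far _ _ (by linarith) (by linarith))
  obtain ⟨C3, hC3, h3⟩ := term_bound hN α τ p X (1 - α / N - ε) (τ / N + ε)
    (1 + α / N - τ / N - X) (Set.Ici 1) (Set.Iio 1) measurableSet_Ici measurableSet_Iio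
    (by linarith) x1 (by linarith) (by linarith) (by linarith) (by linarith) (by linarith)
    (by ring) x2 x3 (by linarith) (by linarith) (far _ _ (by linarith) (by linarith))
    (near _ _ (by linarith) (by linarith))
  obtain ⟨C4, hC4, h4⟩ := term_bound hN α τ p X (1 - α / N - ε) (τ / N - ε)
    (1 + α / N - τ / N - X + 2 * ε) (Set.Ici 1) (Set.Ici 1) measurableSet_Ici measurableSet_Ici
    (by linarith) x1 (by linarith) (by linarith) (by linarith) (by linarith) (by linarith)
    (by ring) x2 x3 (by linarith) (by linarith) (far _ _ (by linarith) (by linarith))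
    (far _ _ (by linarith) (by linarith))
  refine ⟨C1 + C2 + C3 + C4, by simp [hC1, hC2, hC3, hC4], fun u hu hc A G hA hG hAu hGu => ?_⟩
  have hum : Measurable u := hu.continuous.measurable
  have meas : ∀ P1 P2 : Set ℝ, MeasurableSet P1 → MeasurableSet P2 → Measurable
      (fun z : EuclideanSpace ℝ (Fin N) × EuclideanSpace ℝ (Fin N) => ‖u z.1‖ₑ ^ p *
        kf P1 (A / G) (N - α) (z.1 - z.2) * (kf P2 (A / G) τ z.2 * ‖u z.2‖ₑ ^ p)) := by
    intro P1 P2 hP1 hP2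
    have := kf_measurable (N := N) P1 hP1 (A / G) (N - α)
    have := kf_measurable (N := N) P2 hP2 (A / G) τ
    fun_prop
  have m1 := meas _ _ (measurableSet_Iio (a := (1:ℝ))) (measurableSet_Iio (a := (1:ℝ)))
  have m2 := meas _ _ (measurableSet_Iio (a := (1:ℝ))) (measurableSet_Ici (a := (1:ℝ)))
  have m3 := meas _ _ (measurableSet_Ici (a := (1:ℝ))) (measurableSet_Iio (a := (1:ℝ)))
  have m4 := meas _ _ (measurableSet_Ici (a := (1:ℝ))) (measurableSet_Ici (a := (1:ℝ)))
  have hex : ∀ x y, ‖u x‖ₑ ^ p * ENNReal.ofReal (‖x - y‖ ^ (α - N)) *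
        (ENNReal.ofReal (‖y‖ ^ (-τ)) * ‖u y‖ₑ ^ p) =
      ‖u x‖ₑ ^ p * kf (Set.Iio 1) (A / G) (N - α) (x - y) *
        (kf (Set.Iio 1) (A / G) τ y * ‖u y‖ₑ ^ p) +
      ‖u x‖ₑ ^ p * kf (Set.Iio 1) (A / G) (N - α) (x - y) *
        (kf (Set.Ici 1) (A / G) τ y * ‖u y‖ₑ ^ p) +
      ‖u x‖ₑ ^ p * kf (Set.Ici 1) (A / G) (N - α) (x - y) *
        (kf (Set.Iio 1) (A / G) τ y * ‖u y‖ₑ ^ p) +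
      ‖u x‖ₑ ^ p * kf (Set.Ici 1) (A / G) (N - α) (x - y) *
        (kf (Set.Ici 1) (A / G) τ y * ‖u y‖ₑ ^ p) := by
    intro x y
    rw [show α - N = -(N - α) by ring, kf_add (A / G) (N - α), kf_add (A / G) τ]
    ring
  simp only [hex]
  have i1 : ∀ x, Measurable _ := fun x => m1.comp (measurable_prodMk_left (x := x))
  have i2 : ∀ x, Measurable _ := fun x => m2.comp (measurable_prodMk_left (x := x))
  have i3 : ∀ x, Measurable _ := fun x => m3.comp (measurable_prodMk_left (x := x))
  have hin : ∀ x, _ := fun x => lintegral_add_left (μ := volume) ((((i1 x).add (i2 x)).add (i3 x)))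
    (fun y => ‖u x‖ₑ ^ p * kf (Set.Ici 1) (A / G) (N - α) (x - y) *
        (kf (Set.Ici 1) (A / G) τ y * ‖u y‖ₑ ^ p))
  have hin2 : ∀ x, _ := fun x => lintegral_add_left (μ := volume) ((((i1 x).add (i2 x))))
    (fun y => ‖u x‖ₑ ^ p * kf (Set.Ici 1) (A / G) (N - α) (x - y) *
        (kf (Set.Iio 1) (A / G) τ y * ‖u y‖ₑ ^ p))
  have hin3 : ∀ x, _ := fun x => lintegral_add_left (μ := volume) ((((i1 x))))
    (fun y => ‖u x‖ₑ ^ p * kf (Set.Iio 1) (A / G) (N - α) (x - y) *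
        (kf (Set.Ici 1) (A / G) τ y * ‖u y‖ₑ ^ p))
  simp only [Pi.add_apply, Function.comp_apply] at hin hin2 hin3
  simp only [hin, hin2, hin3]
  rw [lintegral_add_left, lintegral_add_left, lintegral_add_left]
  · rw [add_mul, add_mul, add_mul]
    gcongr
    · exact h1 u hu hc A G hA hG hAu hGu
    · exact h2 u hu hc A G hA hG hAu hGu
    · exact h3 u hu hc A G hA hG hAu hGu
    · exact h4 u hu hc A G hA hG hAu hGu
  · exact m1.lintegral_prod_right'
  · exact m1.lintegral_prod_right'.add m2.lintegral_prod_right'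
  · exact (m1.lintegral_prod_right'.add m2.lintegral_prod_right').add m3.lintegral_prod_right'
lemma aA_eq {N : ℕ} (u : EuclideanSpace ℝ (Fin N) → ℂ) (hu : ContDiff ℝ (⊤ : ℕ∞) u)
    (hc : HasCompactSupport u) : aA u = ENNReal.ofReal (l2norm u) := by
  have hi : Integrable (fun x => ‖u x‖ ^ 2) := by
    apply Continuous.integrable_of_hasCompactSupport (by have := hu.continuous; fun_prop)
    exact hc.comp_left (g := fun z : ℂ => ‖z‖ ^ 2) (by simp)
  unfold aA l2norm
  rw [← ENNReal.ofReal_rpow_of_nonneg (integral_nonneg fun x => by positivity) (by norm_num),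
    ofReal_integral_eq_lintegral_ofReal hi (ae_of_all _ fun x => by positivity)]
  congr 1
  apply lintegral_congr
  intro x
  rw [← ofReal_norm, ENNReal.ofReal_rpow_of_nonneg (norm_nonneg _) (by norm_num), Real.rpow_two]

lemma gG_eq {N : ℕ} (u : EuclideanSpace ℝ (Fin N) → ℂ) (hu : ContDiff ℝ (⊤ : ℕ∞) u)
    (hc : HasCompactSupport u) :
    gG u = ENNReal.ofReal ((∫ x, gradNormSq u x) ^ ((1:ℝ)/2)) := by
  have hd : Continuous (fderiv ℝ u) := hu.continuous_fderiv (by simp)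
  have hi : Integrable (fun x => gradNormSq u x) := by
    apply Continuous.integrable_of_hasCompactSupport
    · unfold gradNormSq; fun_prop
    · exact (hc.fderiv (𝕜 := ℝ)).comp_left
        (g := fun L : EuclideanSpace ℝ (Fin N) →L[ℝ] ℂ =>
          ∑ i, ‖L (EuclideanSpace.single i 1)‖ ^ 2) (by simp)
  unfold gG
  rw [← ENNReal.ofReal_rpow_of_nonneg (integral_nonneg fun x => gradNormSq_nonneg u x)
      (by norm_num),
    ofReal_integral_eq_lintegral_ofReal hi (ae_of_all _ fun x => gradNormSq_nonneg u x)]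

lemma eq_zero_of_lintegral {N : ℕ} (u : EuclideanSpace ℝ (Fin N) → ℂ) (hu : Continuous u)
    (s : ℝ) (hs : 0 < s) (h : ∫⁻ x, ‖u x‖ₑ ^ s = 0) : u = 0 := by
  have hm : Measurable u := hu.measurable
  rw [lintegral_eq_zero_iff (by fun_prop)] at h
  have : u =ᵐ[volume] 0 := by
    filter_upwards [h] with x hx
    simpa [hs, hs.not_gt] using hx
  exact (hu.ae_eq_iff_eq volume continuous_const).1 this

/-- **Exterior decay of the Hartree nonlinearity, inverse-square potential case.** -/
theorem exterior_decay_hartree (N : ℕ) (hN : 3 ≤ N) (α τ lam p B : ℝ)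
    (hα : 0 < α) (hαN : α < N) (hlam : 0 ≤ lam)
    (hτ : 0 < τ) (hτN : τ < N) (hcnd : 0 < 2 - 2 * τ + α)
    (hτα : τ < 1 + α / N)
    (hp1 : 1 + α / N < p) (hp2 : p < 1 + (2 - 2 * τ + α) / ((N : ℝ) - 2))
    (hB : B = N * p - N - α + 2 * τ) :
    ∃ C > 0, ∀ R : ℝ, 1 ≤ R → ∀ u : EuclideanSpace ℝ (Fin N) → ℂ,
      ContDiff ℝ (⊤ : ℕ∞) u → HasCompactSupport u →
      (∫ x in {x : EuclideanSpace ℝ (Fin N) | R < ‖x‖},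
          ‖x‖ ^ (-τ) * rieszConvR α (fun y => ‖y‖ ^ (-τ) * ‖u y‖ ^ p) x * ‖u x‖ ^ p) ≤
        C * R ^ (-τ) * l2norm u ^ (2 * p - B + τ) * kineticK lam u ^ ((B - τ) / 2) := by
  have hN' : (3:ℝ) ≤ N := by exact_mod_cast hN
  have hN2 : (0:ℝ) < N - 2 := by linarith
  have hN0 : (0:ℝ) < N := by linarith
  have hp0 : 0 < p := by have : 0 < α / N := by positivity
                         linarith
  obtain ⟨C, hC, hI⟩ := hartree_bound hN α τ p hα hαN hτ hp1 hp2
  set c := rieszConst N α with hc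
  have hc0 : 0 ≤ c := by
    rw [hc]; unfold rieszConst
    have := Real.Gamma_pos_of_pos (show 0 < ((N:ℝ) - α) / 2 by linarith)
    have := Real.Gamma_pos_of_pos (show 0 < α / 2 by linarith)
    positivity
  refine ⟨c * C.toReal + 1, by positivity, fun R hR u hu hcs => ?_⟩
  have hl0 : 0 ≤ l2norm u := by unfold l2norm; exact Real.rpow_nonneg (integral_nonneg fun x => by positivity) _
  have hg0 : 0 ≤ ∫ x, gradNormSq u x := integral_nonneg fun x => gradNormSq_nonneg u x
  have hgk : ∫ x, gradNormSq u x ≤ kineticK lam u := by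
    unfold kineticK
    have : 0 ≤ lam * ∫ x, ‖u x‖ ^ 2 / ‖x‖ ^ 2 := mul_nonneg hlam (integral_nonneg fun x => by positivity)
    linarith
  have hk0 := hg0.trans hgk
  have hR0 : 0 < R := by linarith
  by_cases hu0 : u = 0
  · have : ∀ x, ‖u x‖ ^ p = 0 := by intro x; simp [hu0, hp0.ne']
    simp only [this, mul_zero, integral_zero]
    positivity
  have hA : 0 < l2norm u := by
    refine lt_of_le_of_ne hl0 fun h => hu0 ?_
    have := aA_eq u hu hcs
    rw [← h, ENNReal.ofReal_zero] at this
    unfold aA at this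
    rw [ENNReal.rpow_eq_zero_iff_of_pos (by norm_num)] at this
    exact eq_zero_of_lintegral u hu.continuous 2 (by norm_num) this
  have hG : 0 < (∫ x, gradNormSq u x) ^ ((1:ℝ)/2) := by
    refine lt_of_le_of_ne (by positivity) fun h => hu0 ?_
    have h1 := gG_eq u hu hcs
    rw [← h, ENNReal.ofReal_zero] at h1
    obtain ⟨D, -, hD⟩ := sobolev hN
    have h2 := hD u hu hcs
    rw [h1, mul_zero, nonpos_iff_eq_zero, ENNReal.rpow_eq_zero_iff_of_pos (by positivity)] at h2
    exact eq_zero_of_lintegral u hu.continuous _ (by positivity) h2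
  have hmain := hI u hu hcs _ _ hA hG (aA_eq u hu hcs) (gG_eq u hu hcs)
  set A := l2norm u
  set G := (∫ x, gradNormSq u x) ^ ((1:ℝ)/2) with hGdef
  have hum : Measurable u := hu.continuous.measurable
  set I := ∫⁻ x, ∫⁻ y, ‖u x‖ₑ ^ p * ENNReal.ofReal (‖x - y‖ ^ (α - N)) *
        (ENNReal.ofReal (‖y‖ ^ (-τ)) * ‖u y‖ₑ ^ p) with hIdef
  have hup : ∀ x, ‖‖u x‖ ^ p‖ₑ = ‖u x‖ₑ ^ p := by
    intro x
    rw [Real.enorm_of_nonneg (by positivity), ← ofReal_norm,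
      ENNReal.ofReal_rpow_of_nonneg (norm_nonneg _) hp0.le]
  have hpt : ∀ x, ‖rieszConvR α (fun y => ‖y‖ ^ (-τ) * ‖u y‖ ^ p) x‖ₑ * ‖‖u x‖ ^ p‖ₑ ≤
      ENNReal.ofReal c * ∫⁻ y, ‖u x‖ₑ ^ p * ENNReal.ofReal (‖x - y‖ ^ (α - N)) *
        (ENNReal.ofReal (‖y‖ ^ (-τ)) * ‖u y‖ₑ ^ p) := by
    intro x
    rw [← lintegral_const_mul _ (by fun_prop)]
    unfold rieszConvR
    refine (mul_le_mul_left (enorm_integral_le_lintegral_enorm _) _).trans ?_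
    rw [← lintegral_mul_const _ (by fun_prop)]
    refine lintegral_mono fun y => le_of_eq ?_
    simp only [enorm_mul, hup]
    rw [Real.enorm_of_nonneg hc0, Real.enorm_of_nonneg (by positivity : 0 ≤ ‖x - y‖ ^ (α - (N:ℝ))),
      Real.enorm_of_nonneg (by positivity : 0 ≤ ‖y‖ ^ (-τ))]
    ring
  have hLHS : ENNReal.ofReal (∫ x in {x : EuclideanSpace ℝ (Fin N) | R < ‖x‖},
          ‖x‖ ^ (-τ) * rieszConvR α (fun y => ‖y‖ ^ (-τ) * ‖u y‖ ^ p) x * ‖u x‖ ^ p) ≤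
      ENNReal.ofReal (R ^ (-τ)) * (ENNReal.ofReal c * I) := by
    refine (Real.ofReal_le_enorm _).trans ?_
    refine (enorm_integral_le_lintegral_enorm _).trans ?_
    calc _ ≤ ∫⁻ x in {x : EuclideanSpace ℝ (Fin N) | R < ‖x‖}, ENNReal.ofReal (R ^ (-τ)) *
          (ENNReal.ofReal c * ∫⁻ y, ‖u x‖ₑ ^ p * ENNReal.ofReal (‖x - y‖ ^ (α - N)) *
        (ENNReal.ofReal (‖y‖ ^ (-τ)) * ‖u y‖ₑ ^ p)) := by
          refine setLIntegral_mono' (measurableSet_lt measurable_const measurable_norm) ?_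
          intro x hx
          rw [enorm_mul, enorm_mul, mul_assoc]
          refine mul_le_mul' ?_ (hpt x)
          rw [Real.enorm_of_nonneg (by positivity)]
          exact ENNReal.ofReal_le_ofReal
            (Real.rpow_le_rpow_of_nonpos hR0 (le_of_lt hx) (by linarith))
      _ ≤ ∫⁻ x, ENNReal.ofReal (R ^ (-τ)) *
          (ENNReal.ofReal c * ∫⁻ y, ‖u x‖ₑ ^ p * ENNReal.ofReal (‖x - y‖ ^ (α - N)) *
        (ENNReal.ofReal (‖y‖ ^ (-τ)) * ‖u y‖ₑ ^ p)) := setLIntegral_le_lintegral _ _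
      _ = _ := by
          rw [lintegral_const_mul' _ _ ENNReal.ofReal_ne_top,
            lintegral_const_mul' _ _ ENNReal.ofReal_ne_top]
  have hexp1 : 2 * p - (N * p - N - α + τ) = 2 * p - B + τ := by rw [hB]; ring
  have hexp2 : N * p - N - α + τ = B - τ := by rw [hB]; ring
  rw [hexp1, hexp2] at hmain
  have hBτ : 0 ≤ B - τ := by
    rw [← hexp2]
    have := mul_lt_mul_of_pos_right hp1 hN0
    rw [add_mul, div_mul_cancel₀ _ hN0.ne'] at this
    linarith
  have hfin : ENNReal.ofReal (∫ x in {x : EuclideanSpace ℝ (Fin N) | R < ‖x‖},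
          ‖x‖ ^ (-τ) * rieszConvR α (fun y => ‖y‖ ^ (-τ) * ‖u y‖ ^ p) x * ‖u x‖ ^ p) ≤
      ENNReal.ofReal (R ^ (-τ) * (c * (C.toReal * (A ^ (2 * p - B + τ) * G ^ (B - τ))))) := by
    refine hLHS.trans ?_
    rw [ENNReal.ofReal_mul (by positivity), ENNReal.ofReal_mul hc0,
      ENNReal.ofReal_mul ENNReal.toReal_nonneg, ENNReal.ofReal_toReal hC]
    gcongr
  rw [ENNReal.ofReal_le_ofReal_iff (by positivity)] at hfin
  refine hfin.trans ?_
  have hGk : G ^ (B - τ) ≤ kineticK lam u ^ ((B - τ) / 2) := by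
    rw [hGdef, ← Real.rpow_mul hg0, show (1:ℝ) / 2 * (B - τ) = (B - τ) / 2 by ring]
    exact Real.rpow_le_rpow hg0 hgk (by linarith)
  calc R ^ (-τ) * (c * (C.toReal * (A ^ (2 * p - B + τ) * G ^ (B - τ))))
      = (c * C.toReal) * R ^ (-τ) * A ^ (2 * p - B + τ) * G ^ (B - τ) := by ring
    _ ≤ (c * C.toReal + 1) * R ^ (-τ) * A ^ (2 * p - B + τ) * kineticK lam u ^ ((B - τ) / 2) := by
        gcongr
        linarith
end
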